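/- arXiv:2405.08709 — 2 statements merged into one kernel-verified Lean document; each statement's English description precedes it below -/
import Mathlib

section
/- Let S, Y be random variables on a probability space with values in nonempty finite sets and let 0 ≤ ε < I(S;Y). Then there exist a probability space carrying random variables S', Y' whose joint distribution equals that of (S,Y) and a random variable U with values in some nonempty finite set such that I(U;S') ≤ ε and I(U;Y') ≥ H(Y|S) − H(S|Y) + ε (equivalently, ≥ H(Y) − H(S) + ε). This is the achievability of the lower bound L_h^1(ε) of Theorem 1. -/
open MeasureTheory ProbabilityTheory Real

noncomputable section

/-- The probability mass function of a random variable `X` under the measure `μ`. -/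
def pm {Ω : Type*} [MeasurableSpace Ω] (μ : Measure Ω) {𝒳 : Type*} (X : Ω → 𝒳) (x : 𝒳) : ℝ :=
  (μ (X ⁻¹' {x})).toReal

/-- Shannon entropy (base 2) of a finite-valued random variable. -/
def ent {Ω : Type*} [MeasurableSpace Ω] (μ : Measure Ω) {𝒳 : Type*} [Fintype 𝒳]
    (X : Ω → 𝒳) : ℝ :=
  -∑ x, pm μ X x * Real.logb 2 (pm μ X x)

/-- Conditional entropy `H(X|Y) = H(X,Y) - H(Y)` (base 2). -/
def condEnt {Ω : Type*} [MeasurableSpace Ω] (μ : Measure Ω) {𝒳 𝒴 : Type*} [Fintype 𝒳]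
    [Fintype 𝒴] (X : Ω → 𝒳) (Y : Ω → 𝒴) : ℝ :=
  ent μ (fun ω => (X ω, Y ω)) - ent μ Y

/-- Mutual information `I(X;Y) = H(X) + H(Y) - H(X,Y)` (base 2). -/
def mi {Ω : Type*} [MeasurableSpace Ω] (μ : Measure Ω) {𝒳 𝒴 : Type*} [Fintype 𝒳]
    [Fintype 𝒴] (X : Ω → 𝒳) (Y : Ω → 𝒴) : ℝ :=
  ent μ X + ent μ Y - ent μ (fun ω => (X ω, Y ω))

/-- Conditional mutual information `I(X;Y|Z) = H(X|Z) + H(Y|Z) - H((X,Y)|Z)` (base 2). -/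
def condMI {Ω : Type*} [MeasurableSpace Ω] (μ : Measure Ω) {𝒳 𝒴 𝒵 : Type*} [Fintype 𝒳]
    [Fintype 𝒴] [Fintype 𝒵] (X : Ω → 𝒳) (Y : Ω → 𝒴) (Z : Ω → 𝒵) : ℝ :=
  condEnt μ X Z + condEnt μ Y Z - condEnt μ (fun ω => (X ω, Y ω)) Z

/-- Entropy expressed through `Real.negMulLog`. -/
lemma ent_eq_sum_negMulLog {Ω : Type*} [MeasurableSpace Ω] (μ : Measure Ω) {𝒳 : Type*}
    [Fintype 𝒳] (X : Ω → 𝒳) : ent μ X = (∑ x, negMulLog (pm μ X x)) / log 2 := by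
  simp only [ent, negMulLog, logb, Finset.sum_div, ← Finset.sum_neg_distrib]
  exact Finset.sum_congr rfl fun x _ => by ring

lemma pm_nonneg {Ω : Type*} [MeasurableSpace Ω] (μ : Measure Ω) {𝒳 : Type*} (X : Ω → 𝒳)
    (x : 𝒳) : 0 ≤ pm μ X x := ENNReal.toReal_nonneg

lemma negMulLog_sum_le {ι : Type*} (s : Finset ι) (a : ι → ℝ) (ha : ∀ i ∈ s, 0 ≤ a i) :
    negMulLog (∑ i ∈ s, a i) ≤ ∑ i ∈ s, negMulLog (a i) := by
  simp only [negMulLog, neg_mul, Finset.sum_neg_distrib, neg_le_neg_iff, Finset.sum_mul]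
  refine Finset.sum_le_sum fun i hi => ?_
  rcases (ha i hi).eq_or_lt with h | h
  · simp [← h]
  · exact mul_le_mul_of_nonneg_left (log_le_log h (Finset.single_le_sum ha hi)) h.le

open Classical in
lemma pm_comp {Ω : Type*} [MeasurableSpace Ω] (μ : Measure Ω) [IsFiniteMeasure μ]
    {𝒳 𝒵 : Type*} [Fintype 𝒳] (X : Ω → 𝒳) (hX : ∀ x, MeasurableSet (X ⁻¹' {x}))
    (g : 𝒳 → 𝒵) (z : 𝒵) :
    pm μ (fun ω => g (X ω)) z = ∑ x with g x = z, pm μ X x := by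
  have h : (fun ω => g (X ω)) ⁻¹' {z} =
      ⋃ x ∈ Finset.univ.filter (fun x => g x = z), X ⁻¹' {x} := by
    ext ω
    simp
  simp only [pm]
  rw [h, measure_biUnion_finset _ fun x _ => hX x, ENNReal.toReal_sum]
  · exact fun _ _ => measure_ne_top _ _
  · intro x _ y _ hxy
    exact Disjoint.preimage _ (by simpa using hxy)

/-- Entropy does not increase under a deterministic map. -/
lemma ent_comp_le {Ω : Type*} [MeasurableSpace Ω] (μ : Measure Ω) [IsFiniteMeasure μ]
    {𝒳 𝒵 : Type*} [Fintype 𝒳] [Fintype 𝒵] (X : Ω → 𝒳)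
    (hX : ∀ x, MeasurableSet (X ⁻¹' {x})) (g : 𝒳 → 𝒵) :
    ent μ (fun ω => g (X ω)) ≤ ent μ X := by
  classical
  rw [ent_eq_sum_negMulLog, ent_eq_sum_negMulLog]
  refine div_le_div_of_nonneg_right ?_ (log_nonneg one_le_two)
  rw [← Finset.sum_fiberwise_of_maps_to (s := Finset.univ) (t := Finset.univ) (g := g)
    (fun _ _ => Finset.mem_univ _)]
  refine Finset.sum_le_sum fun z _ => ?_
  rw [pm_comp μ X hX]
  exact negMulLog_sum_le _ _ fun x _ => pm_nonneg μ X x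

lemma ent_comp_eq {Ω : Type*} [MeasurableSpace Ω] (μ : Measure Ω) [IsFiniteMeasure μ]
    {𝒳 𝒵 : Type*} [Fintype 𝒳] [Fintype 𝒵] (X : Ω → 𝒳) (Z : Ω → 𝒵)
    (hX : ∀ x, MeasurableSet (X ⁻¹' {x})) (hZ : ∀ z, MeasurableSet (Z ⁻¹' {z}))
    (g : 𝒳 → 𝒵) (k : 𝒵 → 𝒳) (hg : ∀ ω, g (X ω) = Z ω) (hk : ∀ ω, k (Z ω) = X ω) :
    ent μ X = ent μ Z := by
  have h₁ := ent_comp_le μ X hX g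
  have h₂ := ent_comp_le μ Z hZ k
  simp only [hg, hk] at h₁ h₂
  exact le_antisymm h₂ h₁

lemma ent_congr_map {Ω Ω' : Type*} [MeasurableSpace Ω] [MeasurableSpace Ω'] {μ : Measure Ω}
    {μ' : Measure Ω'} {𝒳 : Type*} [Fintype 𝒳] [MeasurableSpace 𝒳] [MeasurableSingletonClass 𝒳]
    {X : Ω → 𝒳} {X' : Ω' → 𝒳} (hX : Measurable X) (hX' : Measurable X')
    (h : μ.map X = μ'.map X') : ent μ X = ent μ' X' := by
  have hpm : ∀ x, pm μ X x = pm μ' X' x := fun x => by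
    rw [pm, pm, ← Measure.map_apply hX (measurableSet_singleton x), h,
      Measure.map_apply hX' (measurableSet_singleton x)]
  simp only [ent, hpm]

/-- The measure on a finite type with prescribed point masses. -/
def weightMeasure {α : Type*} [Fintype α] [MeasurableSpace α] (w : α → ℝ) : Measure α :=
  ∑ a, ENNReal.ofReal (w a) • Measure.dirac a

lemma weightMeasure_apply {α : Type*} [Fintype α] [MeasurableSpace α]
    [DiscreteMeasurableSpace α] {w : α → ℝ} (s : Set α) :
    weightMeasure w s = ∑ a, ENNReal.ofReal (w a) * s.indicator 1 a := by
  simp [weightMeasure, Measure.finsetSum_apply]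

lemma isProbabilityMeasure_weightMeasure {α : Type*} [Fintype α] [MeasurableSpace α]
    [DiscreteMeasurableSpace α] {w : α → ℝ} (hw : ∀ a, 0 ≤ w a) (h1 : ∑ a, w a = 1) :
    IsProbabilityMeasure (weightMeasure w) := by
  constructor
  rw [weightMeasure_apply]
  simp [← ENNReal.ofReal_sum_of_nonneg fun a _ => hw a, h1]

open Classical in
lemma pm_weightMeasure {α : Type*} [Fintype α] [MeasurableSpace α]
    [DiscreteMeasurableSpace α] {w : α → ℝ} (hw : ∀ a, 0 ≤ w a) {𝒳 : Type*} (X : α → 𝒳)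
    (x : 𝒳) : pm (weightMeasure w) X x = ∑ a, if X a = x then w a else 0 := by
  rw [pm, weightMeasure_apply, ENNReal.toReal_sum]
  · refine Finset.sum_congr rfl fun a _ => ?_
    by_cases h : X a = x <;> simp [h, hw a]
  · intro a _
    by_cases h : X a = x <;> simp [h]

lemma sum_negMulLog_mul {α β : Type*} [Fintype α] [Fintype β] (p : α → ℝ) (q : β → ℝ)
    (hp : ∑ a, p a = 1) (hq : ∑ b, q b = 1) :
    ∑ x : α × β, negMulLog (p x.1 * q x.2) = ∑ a, negMulLog (p a) + ∑ b, negMulLog (q b) := by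
  simp only [negMulLog_mul, Fintype.sum_prod_type, Finset.sum_add_distrib, ← Finset.sum_mul,
    ← Finset.mul_sum, hp, hq, one_mul]

lemma sum_prod_apply {α β : Type*} [Fintype α] [DecidableEq α] [Fintype β] (q : α → β → ℝ)
    (hq : ∀ a, ∑ b, q a b = 1) : ∑ f : α → β, ∏ a, q a (f a) = 1 := by
  rw [← Fintype.prod_sum]
  simp [hq]

lemma sum_ite_prod_apply {α β : Type*} [Fintype α] [DecidableEq α] [Fintype β] [DecidableEq β]
    (q : α → β → ℝ) (hq : ∀ a, ∑ b, q a b = 1) (a₀ : α) (b₀ : β) :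
    ∑ f : α → β, (if f a₀ = b₀ then ∏ a, q a (f a) else 0) = q a₀ b₀ := by
  have h : ∀ f : α → β, (if f a₀ = b₀ then ∏ a, q a (f a) else 0) =
      ∏ a, (if a = a₀ then (if f a = b₀ then q a (f a) else 0) else q a (f a)) := by
    intro f
    by_cases hf : f a₀ = b₀
    · rw [if_pos hf]
      refine Finset.prod_congr rfl fun a _ => ?_
      by_cases ha : a = a₀
      · subst ha
        simp [hf]
      · simp [ha]
    · rw [if_neg hf]
      exact (Finset.prod_eq_zero (Finset.mem_univ a₀) (by simp [hf])).symm
  simp only [h]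
  rw [← Fintype.prod_sum (f := fun a b => if a = a₀ then (if b = b₀ then q a b else 0) else q a b),
    Finset.prod_eq_single a₀]
  · simp
  · intro a _ ha
    simp [ha, hq]
  · simp

lemma exists_stochastic_factor {α β : Type*} [Fintype α] [Fintype β] [Nonempty β]
    (P : α → β → ℝ) (hP : ∀ a b, 0 ≤ P a b) :
    ∃ q : α → β → ℝ, (∀ a b, 0 ≤ q a b) ∧ (∀ a, ∑ b, q a b = 1) ∧
      ∀ a b, (∑ b', P a b') * q a b = P a b := by
  classical
  have key : ∀ a, ∃ q : β → ℝ, (∀ b, 0 ≤ q b) ∧ ∑ b, q b = 1 ∧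
      ∀ b, (∑ b', P a b') * q b = P a b := by
    intro a
    by_cases h : ∑ b', P a b' = 0
    · refine ⟨Pi.single (Classical.arbitrary β) 1, fun b => ?_, by simp, fun b => ?_⟩
      · by_cases hb : b = Classical.arbitrary β <;> simp [hb]
      · rw [h, zero_mul]
        exact ((Finset.sum_eq_zero_iff_of_nonneg fun b _ => hP a b).1 h b
          (Finset.mem_univ b)).symm
    · exact ⟨fun b => P a b / ∑ b', P a b',
        fun b => div_nonneg (hP a b) (Finset.sum_nonneg fun b _ => hP a b),
        by rw [← Finset.sum_div, div_self h], fun b => mul_div_cancel₀ _ h⟩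
  choose q h₀ h₁ h₂ using key
  exact ⟨q, h₀, h₁, h₂⟩

/-- Point masses of a random symbol `a`, a random function `f`, and an independent coin. -/
def frlWeight {α β : Type*} [Fintype α] (p : α → ℝ) (q : α → β → ℝ) (t : ℝ)
    (ω : α × (α → β) × Bool) : ℝ :=
  p ω.1 * ((∏ a, q a (ω.2.1 a)) * bif ω.2.2 then t else 1 - t)

/-- The random function together with the symbol, the latter erased when the coin is `false`. -/
def frlCode {α β : Type*} (ω : α × (α → β) × Bool) : (α → β) × Option α :=
  (ω.2.1, bif ω.2.2 then some ω.1 else none)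

lemma frlWeight_nonneg {α β : Type*} [Fintype α] {p : α → ℝ} {q : α → β → ℝ} {t : ℝ}
    (hp : ∀ a, 0 ≤ p a) (hq : ∀ a b, 0 ≤ q a b)
    (ht₀ : 0 ≤ t) (ht₁ : t ≤ 1) (ω : α × (α → β) × Bool) : 0 ≤ frlWeight p q t ω := by
  refine mul_nonneg (hp _) (mul_nonneg (Finset.prod_nonneg fun _ _ => hq _ _) ?_)
  cases ω.2.2 <;> simp <;> linarith

section frl

variable {α β : Type*} [Fintype α] [DecidableEq α] [Fintype β] {p : α → ℝ} {q : α → β → ℝ} {t : ℝ}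

lemma sum_frlWeight (hp₁ : ∑ a, p a = 1) (hq₁ : ∀ a, ∑ b, q a b = 1) :
    ∑ ω, frlWeight p q t ω = 1 := by
  simp [frlWeight, Fintype.sum_prod_type, ← Finset.mul_sum, hp₁, sum_prod_apply q hq₁]

variable [MeasurableSpace α] [DiscreteMeasurableSpace α] [MeasurableSpace β]
  [DiscreteMeasurableSpace β]

lemma pm_frl_pair (hp : ∀ a, 0 ≤ p a) (hq : ∀ a b, 0 ≤ q a b) (hq₁ : ∀ a, ∑ b, q a b = 1)
    (ht₀ : 0 ≤ t) (ht₁ : t ≤ 1) (a : α) (b : β) :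
    pm (weightMeasure (frlWeight p q t)) (fun ω => (ω.1, ω.2.1 ω.1)) (a, b) = p a * q a b := by
  classical
  rw [pm_weightMeasure (frlWeight_nonneg hp hq ht₀ ht₁), ← sum_ite_prod_apply q hq₁ a b,
    Finset.mul_sum, Fintype.sum_prod_type, Finset.sum_eq_single a]
  · rw [Fintype.sum_prod_type]
    refine Finset.sum_congr rfl fun f _ => ?_
    by_cases h : f a = b
    · simp [h, frlWeight]
      ring
    · simp [h]
  · intro a' _ ha
    simp [ha]
  · simp

lemma pm_frlCode (hp : ∀ a, 0 ≤ p a) (hp₁ : ∑ a, p a = 1) (hq : ∀ a b, 0 ≤ q a b)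
    (ht₀ : 0 ≤ t) (ht₁ : t ≤ 1) (u : (α → β) × Option α) :
    pm (weightMeasure (frlWeight p q t)) frlCode u =
      (∏ a, q a (u.1 a)) * u.2.elim (1 - t) (fun a => t * p a) := by
  classical
  rw [pm_weightMeasure (frlWeight_nonneg hp hq ht₀ ht₁)]
  obtain ⟨f, _ | a⟩ := u
  · simp [Fintype.sum_prod_type, frlCode, frlWeight, ← Finset.sum_mul, hp₁]
  · simp [Fintype.sum_prod_type, frlCode, frlWeight, ite_and]
    ring

lemma pm_frl_fst (hp : ∀ a, 0 ≤ p a) (hq : ∀ a b, 0 ≤ q a b)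
    (hq₁ : ∀ a, ∑ b, q a b = 1) (ht₀ : 0 ≤ t) (ht₁ : t ≤ 1) (a : α) :
    pm (weightMeasure (frlWeight p q t)) Prod.fst a = p a := by
  classical
  rw [pm_weightMeasure (frlWeight_nonneg hp hq ht₀ ht₁), Fintype.sum_prod_type,
    Finset.sum_eq_single a]
  · simp [frlWeight, Fintype.sum_prod_type, ← Finset.mul_sum, sum_prod_apply q hq₁]
  · intro a' _ ha
    simp [ha]
  · simp

lemma mi_frlCode_fst (hp : ∀ a, 0 ≤ p a) (hp₁ : ∑ a, p a = 1)
    (hq : ∀ a b, 0 ≤ q a b) (hq₁ : ∀ a, ∑ b, q a b = 1) (ht₀ : 0 ≤ t) (ht₁ : t ≤ 1) :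
    mi (weightMeasure (frlWeight p q t)) frlCode Prod.fst =
      t * ent (weightMeasure (frlWeight p q t)) Prod.fst := by
  have := isProbabilityMeasure_weightMeasure (frlWeight_nonneg hp hq ht₀ ht₁)
    (sum_frlWeight (t := t) hp₁ hq₁)
  have hid : ent (weightMeasure (frlWeight p q t)) (fun ω => (frlCode ω, ω.1)) =
      ent (weightMeasure (frlWeight p q t)) id :=
    ent_comp_eq _ _ _ (fun _ => MeasurableSet.of_discrete) (fun _ => MeasurableSet.of_discrete)
      (fun x => (x.2, x.1.1, x.1.2.isSome)) (fun ω => (frlCode ω, ω.1))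
      (fun ω => by obtain ⟨a, f, _ | _⟩ := ω <;> rfl) (fun ω => rfl)
  have hpm : ∀ ω, pm (weightMeasure (frlWeight p q t)) id ω = frlWeight p q t ω := fun ω => by
    rw [pm_weightMeasure (frlWeight_nonneg hp hq ht₀ ht₁),
      Finset.sum_eq_single ω] <;> simp +contextual
  have hF := sum_prod_apply q hq₁
  rw [mi, hid]
  simp only [ent_eq_sum_negMulLog, hpm, pm_frlCode hp hp₁ hq ht₀ ht₁,
    pm_frl_fst hp hq hq₁ ht₀ ht₁, frlWeight]
  have hcoin : ∑ c : Bool, (bif c then t else 1 - t) = 1 := by simp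
  have hopt : ∑ o : Option α, o.elim (1 - t) (fun a => t * p a) = 1 := by
    simp [Fintype.sum_option, ← Finset.mul_sum, hp₁]
  rw [sum_negMulLog_mul (fun f : α → β => ∏ a, q a (f a)) _ hF hopt,
    sum_negMulLog_mul p (fun x : (α → β) × Bool =>
      (∏ a, q a (x.1 a)) * bif x.2 then t else 1 - t) hp₁ (by
        simp [Fintype.sum_prod_type, ← Finset.mul_sum, hF]),
    sum_negMulLog_mul (fun f : α → β => ∏ a, q a (f a)) _ hF hcoin]
  simp only [Fintype.sum_option, Option.elim, negMulLog_mul, Finset.sum_add_distrib,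
    ← Finset.sum_mul, ← Finset.mul_sum, hp₁, Fintype.sum_bool, cond_true, cond_false]
  ring

end frl

/-- achievability of `L_h^1(ε)` in Theorem 1. For `0 ≤ ε < I(S;Y)` there is a
probability space carrying `(S',Y')` with the same joint distribution as `(S,Y)` and a
finite-valued `U` with `I(U;S') ≤ ε` and `I(U;Y') ≥ H(Y|S) − H(S|Y) + ε`. -/
theorem exists_EFRL_lower_bound_L1
    {Ω : Type*} [MeasurableSpace Ω] (μ : Measure Ω) [IsProbabilityMeasure μ]
    {𝒮 𝒴 : Type*}
    [Fintype 𝒮] [Nonempty 𝒮] [MeasurableSpace 𝒮] [MeasurableSingletonClass 𝒮]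
    [Fintype 𝒴] [Nonempty 𝒴] [MeasurableSpace 𝒴] [MeasurableSingletonClass 𝒴]
    (S : Ω → 𝒮) (Y : Ω → 𝒴) (hS : Measurable S) (hY : Measurable Y)
    (ε : ℝ) (hε0 : 0 ≤ ε) (hε : ε < mi μ S Y) :
    ∃ (Ω' : Type) (mΩ' : MeasurableSpace Ω'), haveI := mΩ';
    ∃ (μ' : Measure Ω'), IsProbabilityMeasure μ' ∧
    ∃ (S' : Ω' → 𝒮) (Y' : Ω' → 𝒴), Measurable S' ∧ Measurable Y' ∧
      Measure.map (fun ω => (S' ω, Y' ω)) μ' = Measure.map (fun ω => (S ω, Y ω)) μ ∧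
      ∃ (𝒰 : Type) (iF : Fintype 𝒰) (iN : Nonempty 𝒰) (iM : MeasurableSpace 𝒰),
        haveI := iF; haveI := iM;
      ∃ (iMS : MeasurableSingletonClass 𝒰) (U : Ω' → 𝒰), Measurable U ∧
        mi μ' U S' ≤ ε ∧ condEnt μ Y S - condEnt μ S Y + ε ≤ mi μ' U Y' := by
  let σ := Fin (Fintype.card 𝒮)
  let τ := Fin (Fintype.card 𝒴)
  let eS : 𝒮 ≃ σ := Fintype.equivFin 𝒮
  let eY : 𝒴 ≃ τ := Fintype.equivFin 𝒴
  have : Nonempty τ := ⟨eY (Classical.arbitrary 𝒴)⟩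
  have : Nonempty σ := ⟨eS (Classical.arbitrary 𝒮)⟩
  have hSY : Measurable (fun ω => (S ω, Y ω)) := hS.prodMk hY
  have hSYs : ∀ x, MeasurableSet ((fun ω => (S ω, Y ω)) ⁻¹' {x}) :=
    fun x => hSY (measurableSet_singleton x)
  let P : σ → τ → ℝ := fun a b => pm μ (fun ω => (S ω, Y ω)) (eS.symm a, eY.symm b)
  have hP : ∀ a b, 0 ≤ P a b := fun a b => pm_nonneg _ _ _
  obtain ⟨q, hq, hq₁, hPq⟩ := exists_stochastic_factor P hP
  let p : σ → ℝ := fun a => ∑ b, P a b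
  have hp : ∀ a, 0 ≤ p a := fun a => Finset.sum_nonneg fun b _ => hP a b
  have hp₁ : ∑ a, p a = 1 := by
    have h : pm μ (fun ω => (fun _ : 𝒮 × 𝒴 => ()) (S ω, Y ω)) () = 1 := by simp [pm]
    rw [pm_comp μ _ hSYs (fun _ : 𝒮 × 𝒴 => ())] at h
    simp only [Finset.filter_true, Fintype.sum_prod_type] at h
    rw [← h, ← eS.symm.sum_comp]
    exact Finset.sum_congr rfl fun a _ => eY.symm.sum_comp
      (fun y => pm μ (fun ω => (S ω, Y ω)) (eS.symm a, y))
  have hYle : ent μ Y ≤ ent μ (fun ω => (S ω, Y ω)) := ent_comp_le μ _ hSYs Prod.snd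
  have hswap : ent μ (fun ω => (S ω, Y ω)) = ent μ (fun ω => (Y ω, S ω)) :=
    ent_comp_eq μ _ _ hSYs (fun x => (hY.prodMk hS) (measurableSet_singleton x))
      Prod.swap Prod.swap (fun _ => rfl) (fun _ => rfl)
  have hεS : ε < ent μ S := by
    unfold mi at hε
    linarith
  have hSpos : 0 < ent μ S := hε0.trans_lt hεS
  have ht₀ : 0 ≤ ε / ent μ S := div_nonneg hε0 hSpos.le
  have ht₁ : ε / ent μ S ≤ 1 := (div_le_one hSpos).2 hεS.le
  let μ' : Measure (σ × (σ → τ) × Bool) := weightMeasure (frlWeight p q (ε / ent μ S))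
  have hμ' : IsProbabilityMeasure μ' := isProbabilityMeasure_weightMeasure
    (frlWeight_nonneg hp hq ht₀ ht₁) (sum_frlWeight hp₁ hq₁)
  let S' : σ × (σ → τ) × Bool → 𝒮 := fun ω => eS.symm ω.1
  let Y' : σ × (σ → τ) × Bool → 𝒴 := fun ω => eY.symm (ω.2.1 ω.1)
  have hS' : Measurable S' := measurable_of_countable _
  have hY' : Measurable Y' := measurable_of_countable _
  have hmap : μ'.map (fun ω => (S' ω, Y' ω)) = μ.map (fun ω => (S ω, Y ω)) := by
    refine Measure.ext_of_singleton fun x => ?_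
    rw [Measure.map_apply (hS'.prodMk hY') (measurableSet_singleton x),
      Measure.map_apply hSY (measurableSet_singleton x),
      ← ENNReal.toReal_eq_toReal_iff' (measure_ne_top _ _) (measure_ne_top _ _)]
    obtain ⟨s, y⟩ := x
    have h := pm_frl_pair hp hq hq₁ ht₀ ht₁ (eS s) (eY y)
    rw [hPq] at h
    simp only [P, Equiv.symm_apply_apply] at h
    rw [pm, pm] at h
    rw [← h]
    congr 2
    ext ω
    simp [S', Y', Equiv.symm_apply_eq]
  have hSent : ent μ' S' = ent μ S := by
    refine ent_congr_map hS' hS ?_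
    have h := congrArg (Measure.map Prod.fst) hmap
    rwa [Measure.map_map measurable_fst (hS'.prodMk hY'), Measure.map_map measurable_fst hSY] at h
  have hYent : ent μ' Y' = ent μ Y := by
    refine ent_congr_map hY' hY ?_
    have h := congrArg (Measure.map Prod.snd) hmap
    rwa [Measure.map_map measurable_snd (hS'.prodMk hY'), Measure.map_map measurable_snd hSY] at h
  have hdisc : ∀ s : Set (σ × (σ → τ) × Bool), MeasurableSet s := fun _ => .of_discrete
  have hfst : ent μ' Prod.fst = ent μ' S' :=
    ent_comp_eq μ' _ _ (fun _ => hdisc _) (fun _ => hdisc _) eS.symm eS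
      (fun _ => rfl) (fun ω => by simp [S'])
  have hpair : ent μ' (fun ω => (frlCode ω, ω.1)) = ent μ' (fun ω => (frlCode ω, S' ω)) :=
    ent_comp_eq μ' _ _ (fun _ => hdisc _) (fun _ => hdisc _)
      (fun x => (x.1, eS.symm x.2)) (fun x => (x.1, eS x.2))
      (fun _ => rfl) (fun ω => by simp [S'])
  have hmi : mi μ' frlCode S' = ε := by
    have h : mi μ' frlCode Prod.fst = ε / ent μ S * ent μ' Prod.fst :=
      mi_frlCode_fst hp hp₁ hq hq₁ ht₀ ht₁
    rw [mi, hpair, hfst, hSent, div_mul_cancel₀ _ hSpos.ne'] at h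
    rw [mi, hSent, h]
  have hUY : ent μ' (fun ω => (frlCode ω, Y' ω)) ≤ ent μ' (fun ω => (frlCode ω, S' ω)) := by
    rw [← hpair]
    exact ent_comp_le μ' (fun ω => (frlCode ω, ω.1)) (fun _ => hdisc _)
      (fun x => (x.1, eY.symm (x.1.1 x.2)))
  let mU : MeasurableSpace ((σ → τ) × Option σ) := ⊤
  refine ⟨σ × (σ → τ) × Bool, inferInstance, μ', hμ', S', Y', hS', hY', hmap,
    (σ → τ) × Option σ, inferInstance, inferInstance, mU, ⟨fun _ => trivial⟩, frlCode,
    fun _ _ => hdisc _, hmi.le, ?_⟩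
  unfold mi at hmi ⊢
  unfold condEnt
  rw [hSent] at hmi
  rw [hYent]
  linarith
end
end

section
/- Let S1, S2, Y be random variables on a probability space with values in nonempty finite sets, write S = (S1,S2), and let ε satisfy 0 ≤ ε < I(S;Y) and ε ≤ H(S2) with H(S2) > 0; set α2 = ε/H(S2). Then there exist a probability space carrying random variables S1', S2', Y' whose joint distribution equals that of (S1,S2,Y) and a finite-valued random variable U such that I(U;(S1',S2')) ≤ ε and I(U;Y') ≥ H(Y|S) + ε − (log(I(S;Y)+1) + 4) − α2·H(S2|Y), where log is base 2. This establishes, for a fixed representation S=(S1,S2), the lower bound L_h^3(ε) of Theorem 1. -/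
open MeasureTheory ProbabilityTheory Real

noncomputable section

section FiniteLaws

variable {Ω α β γ : Type*} [Fintype Ω] [Fintype α] [Fintype β] [Fintype γ]

open Classical in
/-- The law of `X` under the weights `m` on a finite space. -/
def law {Ω α : Type*} [Fintype Ω] (m : Ω → ℝ) (X : Ω → α) (x : α) : ℝ :=
  ∑ ω, if X ω = x then m ω else 0

/-- The entropy (in nats) of `X` under the weights `m` on a finite space. -/
def lawEnt {Ω α : Type*} [Fintype Ω] [Fintype α] (m : Ω → ℝ) (X : Ω → α) : ℝ :=
  ∑ x, negMulLog (law m X x)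

theorem law_nonneg {α : Type*} {m : Ω → ℝ} (hm : ∀ ω, 0 ≤ m ω) (X : Ω → α) (x : α) :
    0 ≤ law m X x :=
  Finset.sum_nonneg fun ω _ => by split_ifs <;> simp [hm]

theorem le_law {α : Type*} {m : Ω → ℝ} (hm : ∀ ω, 0 ≤ m ω) (X : Ω → α) (ω : Ω) :
    m ω ≤ law m X (X ω) := by
  classical
  have := Finset.single_le_sum (f := fun ω' => if X ω' = X ω then m ω' else 0)
    (fun ω' _ => by split_ifs <;> simp [hm]) (Finset.mem_univ ω)
  simpa [law] using this

theorem sum_law_mul (m : Ω → ℝ) (X : Ω → α) (g : α → ℝ) :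
    ∑ x, law m X x * g x = ∑ ω, m ω * g (X ω) := by
  classical
  simp only [law, Finset.sum_mul]
  rw [Finset.sum_comm]
  simp [ite_mul]

theorem sum_law (m : Ω → ℝ) (X : Ω → α) : ∑ x, law m X x = ∑ ω, m ω := by
  simpa using sum_law_mul m X fun _ => 1

theorem sum_law_pair {γ : Type*} (m : Ω → ℝ) (X : Ω → α) (Z : Ω → γ) (z : γ) :
    ∑ x, law m (fun ω => (X ω, Z ω)) (x, z) = law m Z z := by
  classical
  simp only [law, Prod.ext_iff]
  rw [Finset.sum_comm]
  refine Finset.sum_congr rfl fun ω _ => ?_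
  by_cases h : Z ω = z <;> simp [h]

theorem law_comp {β : Type*} (m : Ω → ℝ) (X : Ω → α) (g : α → β) :
    law (law m X) g = law m (fun ω => g (X ω)) := by
  classical
  funext y
  have := sum_law_mul m X fun x => if g x = y then 1 else 0
  simpa [law] using this

theorem law_inj_comp {α β : Type*} (m : Ω → ℝ) (X : Ω → α) {g : α → β}
    (hg : Function.Injective g) (x : α) : law m (fun ω => g (X ω)) (g x) = law m X x := by
  classical
  simp only [law, hg.eq_iff]

theorem lawEnt_eq_sum_log (m : Ω → ℝ) (X : Ω → α) :
    lawEnt m X = ∑ ω, m ω * -log (law m X (X ω)) := by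
  rw [← sum_law_mul m X fun x => -log (law m X x)]
  simp [lawEnt, negMulLog]

theorem lawEnt_inj_comp (m : Ω → ℝ) (X : Ω → α) {g : α → β} (hg : Function.Injective g) :
    lawEnt m (fun ω => g (X ω)) = lawEnt m X := by
  simp only [lawEnt_eq_sum_log, law_inj_comp m X hg]

theorem law_fst_prod {α : Type*} (m : Ω → ℝ) {b : β → ℝ} (hb : ∑ i, b i = 1) (X : Ω → α) :
    law (fun ω : Ω × β => m ω.1 * b ω.2) (fun ω => X ω.1) = law m X := by
  classical
  funext x
  simp only [law, Fintype.sum_prod_type]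
  refine Finset.sum_congr rfl fun ω _ => ?_
  split_ifs <;> simp [← Finset.mul_sum, hb]

theorem law_prod_pair {α γ : Type*} (m : Ω → ℝ) (n : β → ℝ) (X : Ω → α) (Y : β → γ)
    (z : α × γ) :
    law (fun ω : Ω × β => m ω.1 * n ω.2) (fun ω => (X ω.1, Y ω.2)) z
      = law m X z.1 * law n Y z.2 := by
  classical
  simp only [law, Fintype.sum_prod_type, Finset.sum_mul_sum, Prod.ext_iff]
  refine Finset.sum_congr rfl fun ω _ => Finset.sum_congr rfl fun ω' _ => ?_
  by_cases h : X ω = z.1 <;> by_cases h' : Y ω' = z.2 <;> simp [h, h']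

/-- Additivity of entropy for independent variables. -/
theorem lawEnt_prod_pair (m : Ω → ℝ) (n : β → ℝ) (hm : ∑ ω, m ω = 1) (hn : ∑ ω, n ω = 1)
    (X : Ω → α) (Y : β → γ) :
    lawEnt (fun ω : Ω × β => m ω.1 * n ω.2) (fun ω => (X ω.1, Y ω.2))
      = lawEnt m X + lawEnt n Y := by
  simp only [lawEnt, law_prod_pair, Fintype.sum_prod_type, negMulLog_mul, Finset.sum_add_distrib,
    ← Finset.sum_mul, ← Finset.mul_sum, sum_law, hm, hn]
  ring

/-- Entropy of a variable paired with a function of it and of an independent variable. -/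
theorem lawEnt_prod_apply (p : Ω → ℝ) (hp : ∑ ω, p ω = 1) (q : (Ω → β) → ℝ) [DecidableEq Ω] :
    lawEnt (fun ω : Ω × (Ω → β) => p ω.1 * q ω.2) (fun ω => (ω.2, ω.2 ω.1))
      = (∑ f, negMulLog (q f)) + ∑ f, q f * lawEnt p f := by
  classical
  have key : ∀ f y, law (fun ω : Ω × (Ω → β) => p ω.1 * q ω.2) (fun ω => (ω.2, ω.2 ω.1)) (f, y)
      = q f * law p f y := by
    intro f y
    simp only [law, Fintype.sum_prod_type, Prod.ext_iff, Finset.mul_sum]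
    refine Finset.sum_congr rfl fun ω _ => ?_
    rw [Finset.sum_eq_single f]
    · by_cases h : f ω = y <;> simp [h, mul_comm]
    · intro g _ hg
      simp [hg]
    · simp
  rw [← Finset.sum_add_distrib]
  simp only [lawEnt, Fintype.sum_prod_type, key, negMulLog_mul, Finset.sum_add_distrib,
    ← Finset.sum_mul, ← Finset.mul_sum, sum_law, hp, one_mul]

/-- Entropy of a variable paired with an independent erasure of another one. -/
theorem lawEnt_erasure (m : Ω → ℝ) (hm : ∑ ω, m ω = 1) (X : Ω → α) (V : Ω → β) (b : Bool → ℝ) :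
    lawEnt (fun ω : Ω × Bool => m ω.1 * b ω.2)
        (fun ω => (X ω.1, if ω.2 then some (V ω.1) else none))
      = negMulLog (b false) + negMulLog (b true) + b false * lawEnt m X
        + b true * lawEnt m (fun ω => (X ω, V ω)) := by
  classical
  have hnone : ∀ x, law (fun ω : Ω × Bool => m ω.1 * b ω.2)
      (fun ω => (X ω.1, if ω.2 then some (V ω.1) else none)) (x, none)
      = b false * law m X x := by
    intro x
    simp only [law, Fintype.sum_prod_type, Finset.mul_sum]
    refine Finset.sum_congr rfl fun ω _ => ?_
    simp [mul_comm]
  have hsome : ∀ x v, law (fun ω : Ω × Bool => m ω.1 * b ω.2)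
      (fun ω => (X ω.1, if ω.2 then some (V ω.1) else none)) (x, some v)
      = b true * law m (fun ω => (X ω, V ω)) (x, v) := by
    intro x v
    simp only [law, Fintype.sum_prod_type, Finset.mul_sum]
    refine Finset.sum_congr rfl fun ω _ => ?_
    simp [mul_comm]
  have h1 : ∑ x, law m X x = 1 := by rw [sum_law, hm]
  have h2 : ∑ x, ∑ v, law m (fun ω => (X ω, V ω)) (x, v) = 1 := by
    rw [← Fintype.sum_prod_type, sum_law, hm]
  simp only [lawEnt, Fintype.sum_prod_type, Fintype.sum_option, hnone, hsome, negMulLog_mul,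
    Finset.sum_add_distrib, ← Finset.sum_mul, ← Finset.mul_sum, h1, h2]
  ring

/-- Gibbs' inequality, for an unnormalised reference weight `g`. -/
theorem lawEnt_le_cross {m : Ω → ℝ} (hm : ∀ ω, 0 ≤ m ω) (hm1 : ∑ ω, m ω = 1) (X : Ω → α)
    {g : α → ℝ} (hg : ∀ x, 0 ≤ g x) (hpos : ∀ ω, 0 < m ω → 0 < g (X ω)) :
    lawEnt m X ≤ ∑ ω, m ω * -log (g (X ω)) + (∑ x, g x - 1) := by
  have hle : ∑ ω, m ω * (g (X ω) / law m X (X ω)) ≤ ∑ x, g x := by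
    rw [← sum_law_mul m X fun x => g x / law m X x]
    refine Finset.sum_le_sum fun x _ => ?_
    rcases eq_or_ne (law m X x) 0 with h | h
    · simp [h, hg]
    · rw [mul_div_cancel₀ _ h]
  have hpt : ∀ ω, m ω * -log (law m X (X ω))
      ≤ m ω * -log (g (X ω)) + (m ω * (g (X ω) / law m X (X ω)) - m ω) := by
    intro ω
    rcases (hm ω).eq_or_lt with h | h
    · simp [← h]
    · have hl : 0 < law m X (X ω) := h.trans_le (le_law hm X ω)
      have := log_le_sub_one_of_pos (div_pos (hpos ω h) hl)
      rw [log_div (hpos ω h).ne' hl.ne'] at this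
      nlinarith [mul_le_mul_of_nonneg_left this h.le]
  rw [lawEnt_eq_sum_log]
  refine (Finset.sum_le_sum fun ω _ => hpt ω).trans ?_
  rw [Finset.sum_add_distrib, Finset.sum_sub_distrib, hm1]
  linarith

/-- Nonnegativity of the conditional mutual information of `X` and `Y` given `Z`. -/
theorem lawEnt_submodular {m : Ω → ℝ} (hm : ∀ ω, 0 ≤ m ω) (hm1 : ∑ ω, m ω = 1)
    (X : Ω → α) (Y : Ω → β) (Z : Ω → γ) :
    lawEnt m (fun ω => (X ω, Y ω, Z ω)) + lawEnt m Z
      ≤ lawEnt m (fun ω => (X ω, Z ω)) + lawEnt m (fun ω => (Y ω, Z ω)) := by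
  set g : α × β × γ → ℝ := fun t =>
    law m (fun ω => (X ω, Z ω)) (t.1, t.2.2) * law m (fun ω => (Y ω, Z ω)) t.2
      / law m Z t.2.2 with hgdef
  have hg : ∀ t, 0 ≤ g t := fun t =>
    div_nonneg (mul_nonneg (law_nonneg hm _ _) (law_nonneg hm _ _)) (law_nonneg hm _ _)
  have hXZ : ∀ ω, 0 < m ω → 0 < law m (fun ω => (X ω, Z ω)) (X ω, Z ω) := fun ω h =>
    h.trans_le (le_law hm (fun ω => (X ω, Z ω)) ω)
  have hYZ : ∀ ω, 0 < m ω → 0 < law m (fun ω => (Y ω, Z ω)) (Y ω, Z ω) := fun ω h =>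
    h.trans_le (le_law hm (fun ω => (Y ω, Z ω)) ω)
  have hZ : ∀ ω, 0 < m ω → 0 < law m Z (Z ω) := fun ω h => h.trans_le (le_law hm Z ω)
  have hsum : ∑ t, g t ≤ 1 := by
    rw [← hm1, ← sum_law m Z, Fintype.sum_prod_type, Finset.sum_comm, Fintype.sum_prod_type,
      Finset.sum_comm]
    refine Finset.sum_le_sum fun z _ => le_of_eq ?_
    simp only [hgdef]
    simp_rw [← Finset.sum_div, ← Finset.sum_mul, sum_law_pair m X Z, ← Finset.mul_sum, sum_law_pair m Y Z]
    rcases eq_or_ne (law m Z z) 0 with h | h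
    · simp [h]
    · rw [mul_div_cancel_right₀ _ h]
  have hgibbs := lawEnt_le_cross hm hm1 (fun ω => (X ω, Y ω, Z ω)) hg fun ω h =>
    div_pos (mul_pos (hXZ ω h) (hYZ ω h)) (hZ ω h)
  have hsplit : ∑ ω, m ω * -log (g (X ω, Y ω, Z ω))
      = lawEnt m (fun ω => (X ω, Z ω)) + lawEnt m (fun ω => (Y ω, Z ω)) - lawEnt m Z := by
    simp only [lawEnt_eq_sum_log]
    rw [← Finset.sum_add_distrib, ← Finset.sum_sub_distrib]
    refine Finset.sum_congr rfl fun ω _ => ?_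
    rcases (hm ω).eq_or_lt with h | h
    · simp [← h]
    · rw [hgdef]
      simp only
      rw [log_div (mul_pos (hXZ ω h) (hYZ ω h)).ne' (hZ ω h).ne',
        log_mul (hXZ ω h).ne' (hYZ ω h).ne']
      ring
  linarith

end FiniteLaws

section ExponentialRace

variable {ι : Type*} [Fintype ι]

theorem lintegral_expMeasure_one (h : ℝ → ENNReal) (hh : Measurable h) :
    ∫⁻ t, h t ∂(expMeasure 1) = ∫⁻ t in Set.Ioi 0, ENNReal.ofReal (exp (-t)) * h t := by
  rw [← lintegral_indicator measurableSet_Ioi, expMeasure, gammaMeasure,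
    lintegral_withDensity_eq_lintegral_mul₀ (f := gammaPDF 1 1)
      (measurable_gammaPDFReal 1 1).ennreal_ofReal.aemeasurable hh.aemeasurable]
  refine lintegral_congr_ae ?_
  filter_upwards [compl_mem_ae_iff.mpr (measure_singleton (0 : ℝ))] with t ht
  have hpdf := exponentialPDF_eq 1 t
  rw [exponentialPDF, exponentialPDFReal, ← gammaPDF] at hpdf
  rcases lt_or_gt_of_ne (show t ≠ 0 from ht) with h0 | h0
  · simp [hpdf, h0.not_ge, h0.le]
  · simp [hpdf, h0.le, h0]

theorem expMeasure_one_Ioi {x : ℝ} (hx : 0 ≤ x) :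
    expMeasure 1 (Set.Ioi x) = ENNReal.ofReal (exp (-x)) := by
  have := isProbabilityMeasure_expMeasure one_pos
  have h := cdf_expMeasure_eq one_pos x
  rw [cdf_eq_real, if_pos hx, one_mul] at h
  rw [← Set.compl_Iic, ← ofReal_measureReal (by finiteness), probReal_compl_eq_one_sub measurableSet_Iic, h]
  simp

/-- The event that `i` wins the exponential race with rates `k`. -/
def raceSet {ι : Type*} (k : ι → ℝ) (i : ι) : Set (ι → ℝ) :=
  {x | 0 < k i ∧ ∀ j, j ≠ i → x i * k j < x j * k i}

theorem measurableSet_raceSet (k : ι → ℝ) (i : ι) : MeasurableSet (raceSet k i) := by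
  have : raceSet k i = {_x | 0 < k i} ∩ ⋂ j, ⋂ _ : j ≠ i, {x | x i * k j < x j * k i} := by
    ext
    simp [raceSet]
  rw [this]
  refine (MeasurableSet.const _).inter (MeasurableSet.iInter fun j => .iInter fun _ => ?_)
  exact measurableSet_lt (by fun_prop) (by fun_prop)

omit [Fintype ι] in
theorem eq_of_mem_raceSet {k : ι → ℝ} {i j : ι} {x : ι → ℝ} (hi : x ∈ raceSet k i)
    (hj : x ∈ raceSet k j) : i = j := by
  by_contra hne
  exact lt_asymm (hi.2 j (Ne.symm hne)) (hj.2 i hne)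

theorem lintegral_raceSet {k : ι → ℝ} (hk : ∀ i, 0 ≤ k i) (hk1 : ∑ i, k i = 1) {i : ι}
    (hi : 0 < k i) {h : ℝ → ENNReal} (hh : Measurable h) :
    ∫⁻ x in raceSet k i, h (x i) ∂(Measure.pi fun _ : ι => expMeasure 1)
      = ∫⁻ t in Set.Ioi 0, ENNReal.ofReal (exp (-((k i)⁻¹ * t))) * h t := by
  classical
  have := isProbabilityMeasure_expMeasure one_pos
  have hmeas : Measurable ((raceSet k i).indicator fun x : ι → ℝ => h (x i)) :=
    (hh.comp (measurable_pi_apply i)).indicator (measurableSet_raceSet k i)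
  rw [← lintegral_indicator (measurableSet_raceSet k i),
    lintegral_eq_lmarginal_univ (fun _ => (0 : ℝ)),
    lmarginal_erase _ hmeas (Finset.mem_univ i), lintegral_expMeasure_one]
  · refine setLIntegral_congr_fun measurableSet_Ioi fun t ht => ?_
    have ht : 0 < t := ht
    have hind : ∀ y : (∀ j : (Finset.univ.erase i : Finset ι), ℝ),
        (raceSet k i).indicator (fun x : ι → ℝ => h (x i))
          (Function.updateFinset (Function.update (fun _ => (0 : ℝ)) i t) (Finset.univ.erase i) y)
        = (Set.univ.pi fun j : (Finset.univ.erase i : Finset ι) =>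
            Set.Ioi (t * k j / k i)).indicator (fun _ => h t) y := by
      intro y
      have hval : Function.updateFinset (Function.update (fun _ => (0 : ℝ)) i t)
          (Finset.univ.erase i) y i = t := by
        simp [Function.updateFinset]
      rw [Set.indicator_apply, Set.indicator_apply, hval]
      refine if_congr ?_ rfl rfl
      simp only [raceSet, Set.mem_ofPred_eq, hval, hi, true_and, Set.mem_pi, Set.mem_univ,
        true_imp_iff, Set.mem_Ioi, Subtype.forall, div_lt_iff₀ hi, Finset.mem_erase]
      refine forall_congr' fun j => ⟨fun H hj => ?_, fun H hj => ?_⟩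
      · simpa [Function.updateFinset, hj.1] using H hj.1
      · simpa [Function.updateFinset, hj] using H ⟨hj, Finset.mem_univ j⟩
    have hprod : ∏ j : (Finset.univ.erase i : Finset ι), expMeasure 1 (Set.Ioi (t * k j / k i))
        = ENNReal.ofReal (exp (-((k i)⁻¹ * t) + t)) := by
      have : ∀ j : ι, expMeasure 1 (Set.Ioi (t * k j / k i))
          = ENNReal.ofReal (exp (-(t * k j / k i))) := fun j =>
        expMeasure_one_Ioi (div_nonneg (mul_nonneg ht.le (hk j)) hi.le)
      rw [Finset.prod_coe_sort (Finset.univ.erase i)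
        fun j => expMeasure 1 (Set.Ioi (t * k j / k i))]
      simp_rw [this]
      rw [← ENNReal.ofReal_prod_of_nonneg fun _ _ => (exp_pos _).le, ← exp_sum,
        Finset.sum_neg_distrib, ← Finset.sum_div, ← Finset.mul_sum,
        Finset.sum_erase_eq_sub (Finset.mem_univ i), hk1]
      congr 2
      field_simp
      ring
    rw [lmarginal]
    simp_rw [hind]
    rw [lintegral_indicator_const (MeasurableSet.univ_pi fun _ => measurableSet_Ioi),
      Measure.pi_pi, hprod, mul_comm (h t), ← mul_assoc, ← ENNReal.ofReal_mul (exp_pos _).le,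
      ← exp_add]
    congr 3
    ring
  · exact (hmeas.lmarginal _).comp (measurable_update _)

theorem lintegral_rpow_mul_exp_neg {a r : ℝ} (ha : 0 < a) (hr : 0 < r) :
    ∫⁻ t in Set.Ioi 0, ENNReal.ofReal (t ^ (a - 1) * exp (-(r * t)))
      = ENNReal.ofReal ((1 / r) ^ a * Gamma a) := by
  have h := integral_rpow_mul_exp_neg_mul_Ioi ha hr
  rw [← h, ofReal_integral_eq_lintegral_ofReal]
  · refine Integrable.of_integral_ne_zero ?_
    rw [h]
    have := Gamma_pos_of_pos ha
    positivity
  · filter_upwards [self_mem_ae_restrict measurableSet_Ioi] with t ht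
    exact mul_nonneg (rpow_nonneg (le_of_lt ht) _) (exp_pos _).le

theorem measureReal_raceSet {k : ι → ℝ} (hk : ∀ i, 0 ≤ k i) (hk1 : ∑ i, k i = 1) (i : ι) :
    (Measure.pi fun _ : ι => expMeasure 1).real (raceSet k i) = k i := by
  rcases (hk i).eq_or_lt with hi | hi
  · simp [raceSet, ← hi]
  · have h := lintegral_raceSet hk hk1 hi (h := fun _ => 1) measurable_const
    have h' := lintegral_rpow_mul_exp_neg one_pos (inv_pos.2 hi)
    simp only [sub_self, rpow_zero, one_mul, one_div, inv_inv, rpow_one, Gamma_one, mul_one] at h'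
    simp only [lintegral_const, one_mul, Measure.restrict_apply MeasurableSet.univ, Set.univ_inter,
      mul_one, h'] at h
    rw [measureReal_def, h, ENNReal.toReal_ofReal hi.le]

theorem integral_raceSet_abs {k : ι → ℝ} (hk : ∀ i, 0 ≤ k i) (hk1 : ∑ i, k i = 1) (i : ι) :
    IntegrableOn (fun x => |x i|) (raceSet k i) (Measure.pi fun _ : ι => expMeasure 1) ∧
    ∫ x in raceSet k i, |x i| ∂(Measure.pi fun _ : ι => expMeasure 1) = k i ^ 2 := by
  rcases (hk i).eq_or_lt with hi | hi
  · simp [raceSet, ← hi]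
  · have habs := lintegral_raceSet hk hk1 hi (h := fun t => ‖t‖ₑ) (by fun_prop)
    have habs' : ∫⁻ t in Set.Ioi 0, ENNReal.ofReal (exp (-((k i)⁻¹ * t))) * ‖t‖ₑ
        = ENNReal.ofReal (k i ^ 2) := by
      have hmom := lintegral_rpow_mul_exp_neg two_pos (inv_pos.2 hi)
      rw [Gamma_two, one_div, inv_inv, mul_one, rpow_two] at hmom
      rw [← hmom]
      refine setLIntegral_congr_fun measurableSet_Ioi fun t ht => ?_
      have ht : 0 < t := ht
      rw [Real.enorm_of_nonneg ht.le, ← ENNReal.ofReal_mul (exp_pos _).le, mul_comm]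
      norm_num
    have hint : IntegrableOn (fun x => x i) (raceSet k i)
        (Measure.pi fun _ : ι => expMeasure 1) := by
      refine ⟨(measurable_pi_apply i).aestronglyMeasurable, ?_⟩
      rw [HasFiniteIntegral, habs, habs']
      exact ENNReal.ofReal_lt_top
    refine ⟨hint.abs, ?_⟩
    have := integral_norm_eq_lintegral_enorm hint.aestronglyMeasurable
    simp only [Real.norm_eq_abs] at this
    rw [this, habs, habs', ENNReal.toReal_ofReal (sq_nonneg _)]

theorem ae_exists_mem_raceSet {k : ι → ℝ} (hk : ∀ i, 0 ≤ k i) (hk1 : ∑ i, k i = 1) :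
    ∀ᵐ x ∂(Measure.pi fun _ : ι => expMeasure 1), ∃ i, x ∈ raceSet k i := by
  have := isProbabilityMeasure_expMeasure one_pos
  have hU : (Measure.pi fun _ : ι => expMeasure 1).real (⋃ i, raceSet k i) = 1 := by
    rw [measureReal_iUnion_fintype _ (measurableSet_raceSet k)]
    · simp_rw [measureReal_raceSet hk hk1, hk1]
    · intro i j hij
      exact Set.disjoint_left.2 fun x hi hj => hij (eq_of_mem_raceSet hi hj)
  have := (prob_compl_eq_zero_iff (MeasurableSet.iUnion (measurableSet_raceSet k))
    (μ := Measure.pi fun _ : ι => expMeasure 1)).2 (by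
      rw [← ofReal_measureReal (by finiteness), hU, ENNReal.ofReal_one])
  filter_upwards [compl_mem_ae_iff.2 this] with x hx
  simpa using hx

end ExponentialRace

section Coupling

theorem integral_Ioi_pareto {a P : ℝ} (ha : 0 < a) (hP : 0 < P) :
    IntegrableOn (fun t => a * (1 + t / P) ^ (-(1 + a))) (Set.Ioi 0) ∧
    ∫ t in Set.Ioi 0, a * (1 + t / P) ^ (-(1 + a)) = P := by
  have hderiv : ∀ t ∈ Set.Ici (0 : ℝ), HasDerivAt (fun t => -P * (1 + t / P) ^ (-a))
      (a * (1 + t / P) ^ (-(1 + a))) t := by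
    intro t ht
    have ht : 0 ≤ t := ht
    have h0 : 0 < 1 + t / P := by positivity
    have h := ((((hasDerivAt_id t).div_const P).const_add 1).rpow_const
      (p := -a) (Or.inl h0.ne')).const_mul (-P)
    refine h.congr_deriv ?_
    rw [show -(1 + a) = -a - 1 by ring]
    simp only [id]
    field_simp
  have hpos : ∀ t ∈ Set.Ioi (0 : ℝ), 0 ≤ a * (1 + t / P) ^ (-(1 + a)) := by
    intro t ht
    have ht : 0 < t := ht
    positivity
  have hlim : Filter.Tendsto (fun t => -P * (1 + t / P) ^ (-a)) Filter.atTop (nhds 0) := by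
    have h1 : Filter.Tendsto (fun t : ℝ => 1 + t / P) Filter.atTop Filter.atTop :=
      Filter.tendsto_atTop_add_const_left _ _ (Filter.tendsto_id.atTop_div_const hP)
    simpa using ((tendsto_rpow_neg_atTop ha).comp h1).const_mul (-P)
  refine ⟨integrableOn_Ioi_deriv_of_nonneg' hderiv hpos hlim, ?_⟩
  rw [integral_Ioi_of_hasDerivAt_of_nonneg' hderiv hpos hlim]
  simp

theorem integral_pareto_exponential_le {ι : Type*} [Fintype ι] {a P : ℝ} (ha : 0 < a)
    (hP : 0 < P) (i : ι) :
    Integrable (fun x => a * (1 + |x i| / P) ^ (-(1 + a)))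
      (Measure.pi fun _ : ι => expMeasure 1) ∧
    ∫ x, a * (1 + |x i| / P) ^ (-(1 + a)) ∂(Measure.pi fun _ : ι => expMeasure 1) ≤ P := by
  have := isProbabilityMeasure_expMeasure one_pos
  have hnn : ∀ t : ℝ, 0 ≤ a * (1 + |t| / P) ^ (-(1 + a)) := fun t => by positivity
  have hm : Measurable fun t : ℝ => a * (1 + |t| / P) ^ (-(1 + a)) := by fun_prop
  have hl : ∫⁻ x, ENNReal.ofReal (a * (1 + |x i| / P) ^ (-(1 + a)))
      ∂(Measure.pi fun _ : ι => expMeasure 1) ≤ ENNReal.ofReal P := by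
    rw [(measurePreserving_eval (fun _ : ι => expMeasure 1) i).lintegral_comp hm.ennreal_ofReal,
      lintegral_expMeasure_one _ hm.ennreal_ofReal]
    obtain ⟨hi, he⟩ := integral_Ioi_pareto ha hP
    refine le_of_le_of_eq ?_ (congrArg ENNReal.ofReal he)
    rw [ofReal_integral_eq_lintegral_ofReal hi]
    · refine setLIntegral_mono' measurableSet_Ioi fun t ht => ?_
      have ht : 0 < t := ht
      rw [abs_of_pos ht]
      have h1 : ENNReal.ofReal (exp (-t)) ≤ 1 := ENNReal.ofReal_le_one.2 (by simpa using ht.le)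
      exact mul_le_of_le_one_left' h1
    · filter_upwards [self_mem_ae_restrict measurableSet_Ioi] with t ht
      have ht : 0 < t := ht
      positivity
  have hme : Measurable fun x : ι → ℝ => a * (1 + |x i| / P) ^ (-(1 + a)) :=
    hm.comp (measurable_pi_apply i)
  constructor
  · refine ⟨hme.aestronglyMeasurable, ?_⟩
    rw [hasFiniteIntegral_iff_ofReal (.of_forall fun x => hnn _)]
    exact hl.trans_lt ENNReal.ofReal_lt_top
  · rw [integral_eq_lintegral_of_nonneg_ae (.of_forall fun x => hnn _) hme.aestronglyMeasurable]
    exact ENNReal.toReal_le_of_le_ofReal hP.le hl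

theorem exists_race_winner {ι : Type*} [Fintype ι] [Nonempty ι] {k : ι → ℝ}
    (hk : ∀ i, 0 ≤ k i) (hk1 : ∑ i, k i = 1) :
    ∃ F : (ι → ℝ) → ι, (∀ i, MeasurableSet (F ⁻¹' {i})) ∧
      ∀ᵐ x ∂(Measure.pi fun _ : ι => expMeasure 1), x ∈ raceSet k (F x) := by
  classical
  have hae := ae_exists_mem_raceSet hk hk1
  let i₀ : ι := Classical.arbitrary ι
  refine ⟨fun x => if h : ∃ i, x ∈ raceSet k i then h.choose else i₀, fun i => ?_, ?_⟩
  · have : (fun x => if h : ∃ i, x ∈ raceSet k i then h.choose else i₀) ⁻¹' {i}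
        = raceSet k i ∪ ({_x | i₀ = i} ∩ (⋃ j, raceSet k j)ᶜ) := by
      ext x
      by_cases h : ∃ i, x ∈ raceSet k i
      · have h'' : x ∈ ⋃ j, raceSet k j := Set.mem_iUnion.2 h
        have hc := h.choose_spec
        rw [Set.mem_preimage, dif_pos h]
        generalize h.choose = l at hc ⊢
        have h' : ∀ j, x ∈ raceSet k j ↔ l = j := fun j =>
          ⟨eq_of_mem_raceSet hc, fun e => e ▸ hc⟩
        simp only [Set.mem_singleton_iff, Set.mem_union, h', Set.mem_inter_iff,
          Set.mem_compl_iff, h'', not_true_eq_false, and_false, or_false]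
      · have h' : ∀ j, x ∉ raceSet k j := not_exists.1 h
        rw [Set.mem_preimage, dif_neg h]
        simp only [Set.mem_singleton_iff, Set.mem_union, h', false_or, Set.mem_inter_iff,
          Set.mem_compl_iff, Set.mem_iUnion, exists_false, not_false_eq_true, and_true,
          Set.mem_ofPred_eq]
    rw [this]
    exact (measurableSet_raceSet k i).union
      ((MeasurableSet.const _).inter (MeasurableSet.iUnion (measurableSet_raceSet k)).compl)
  · filter_upwards [hae] with x hx
    simp only [dif_pos hx]
    exact hx.choose_spec

theorem integral_finite_range {Ω α : Type*} [MeasurableSpace Ω] [Fintype α] (ν : Measure Ω)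
    [IsProbabilityMeasure ν] {F : Ω → α} (hF : ∀ a, MeasurableSet (F ⁻¹' {a})) (φ : α → ℝ) :
    Integrable (fun x => φ (F x)) ν ∧ ∫ x, φ (F x) ∂ν = ∑ a, ν.real (F ⁻¹' {a}) * φ a := by
  classical
  have heq : (fun x => φ (F x)) = fun x => ∑ a, (F ⁻¹' {a}).indicator (fun _ => φ a) x := by
    funext x
    simp [Set.indicator_apply]
  have hi : ∀ a, Integrable ((F ⁻¹' {a}).indicator fun _ => φ a) ν := fun a =>
    (integrable_const _).indicator (hF a)
  rw [heq]
  refine ⟨integrable_finsetSum _ fun a _ => hi a, ?_⟩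
  rw [integral_finsetSum _ fun a _ => hi a]
  refine Finset.sum_congr rfl fun a _ => ?_
  rw [integral_indicator_const _ (hF a), smul_eq_mul]

theorem neg_log_pareto_le {a r t : ℝ} (ha : 0 < a) (hr : 0 ≤ r) (ht : 0 ≤ t) :
    -log (a * (1 + t) ^ (-(1 + a)))
      ≤ -log a + (1 + a) * (log (1 + r) + (t - r) / (1 + r)) := by
  have h1 : 0 < 1 + t := by positivity
  have h2 : 0 < 1 + r := by positivity
  have h := log_le_sub_one_of_pos (div_pos h1 h2)
  rw [log_div h1.ne' h2.ne', show (1 + t) / (1 + r) - 1 = (t - r) / (1 + r) by field_simp; ring]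
    at h
  rw [log_mul ha.ne' (by positivity), log_rpow h1]
  nlinarith

/-- A random function `f` with prescribed marginals `k s` such that the law of `f s`, for `s`
distributed according to `p`, has small entropy on average. -/
theorem exists_coupling_entropy_le {σ ι : Type*} [Fintype σ] [Fintype ι] [Nonempty ι]
    [DecidableEq σ] {p : σ → ℝ} (hp : ∀ s, 0 ≤ p s) (hp1 : ∑ s, p s = 1) {k : σ → ι → ℝ}
    (hk : ∀ s i, 0 ≤ k s i) (hk1 : ∀ s, ∑ i, k s i = 1) {P : ι → ℝ}
    (hP : ∀ i, P i = ∑ s, p s * k s i) {a : ℝ} (ha : 0 < a) :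
    ∃ q : (σ → ι) → ℝ, (∀ f, 0 ≤ q f) ∧ ∑ f, q f = 1 ∧
      (∀ s i, law q (fun f => f s) i = k s i) ∧
      ∑ f, q f * lawEnt p f
        ≤ -log a + (1 + a) * ∑ s, p s * ∑ i, k s i * log (1 + k s i / P i) := by
  classical
  have := isProbabilityMeasure_expMeasure one_pos
  set ν : Measure (ι → ℝ) := Measure.pi fun _ => expMeasure 1 with hν
  choose F hFm hFae using fun s => exists_race_winner (hk s) (hk1 s)
  have hGm : ∀ f : σ → ι, MeasurableSet ((fun x s => F s x) ⁻¹' {f}) := by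
    intro f
    have : (fun x s => F s x) ⁻¹' {f} = ⋂ s, F s ⁻¹' {f s} := by
      ext x
      simp [funext_iff]
    rw [this]
    exact MeasurableSet.iInter fun s => hFm s (f s)
  have hG := integral_finite_range ν hGm
  have hPnn : ∀ i, 0 ≤ P i := fun i => by
    rw [hP]
    exact Finset.sum_nonneg fun s _ => mul_nonneg (hp s) (hk s i)
  refine ⟨fun f => ν.real ((fun x s => F s x) ⁻¹' {f}), fun f => measureReal_nonneg, ?_, ?_, ?_⟩
  · simpa using (hG fun _ => 1).2.symm
  · intro s i
    have h := (hG fun f => if f s = i then 1 else 0).2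
    simp only [mul_ite, mul_one, mul_zero] at h
    rw [law, ← h, ← measureReal_raceSet (hk s) (hk1 s) i, ← integral_indicator_one
      (measurableSet_raceSet _ _)]
    refine integral_congr_ae ?_
    filter_upwards [hFae s] with x hx
    by_cases hi : F s x = i
    · rw [hi] at hx
      simp [hi, hx]
    · have : x ∉ raceSet (k s) i := fun h => hi (eq_of_mem_raceSet hx h)
      simp [hi, this]
  · rw [← (hG fun f => lawEnt p f).2]
    set c : σ → ι → ℝ → ℝ := fun s i t =>
      -log a + (1 + a) * (log (1 + k s i / P i) + (t / P i - k s i / P i) / (1 + k s i / P i))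
      with hc
    set g : ι → (ι → ℝ) → ℝ := fun i x =>
      if 0 < P i then a * (1 + |x i| / P i) ^ (-(1 + a)) else 0 with hg
    have hcint : ∀ s i, Integrable ((raceSet (k s) i).indicator fun x => c s i |x i|) ν ∧
        ∫ x, (raceSet (k s) i).indicator (fun x => c s i |x i|) x ∂ν
          = k s i * -log a + (1 + a) * (k s i * log (1 + k s i / P i)) := by
      intro s i
      obtain ⟨h1, h2⟩ := integral_raceSet_abs (hk s) (hk1 s) i
      have hceq : (fun x : ι → ℝ => c s i |x i|) = fun x => c s i 0
          + (1 + a) / P i / (1 + k s i / P i) * |x i| := by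
        funext x
        simp only [hc]
        ring
      have hconst : IntegrableOn (fun _ : ι → ℝ => c s i 0) (raceSet (k s) i) ν :=
        (integrable_const _).integrableOn
      rw [integrable_indicator_iff (measurableSet_raceSet _ _),
        integral_indicator (measurableSet_raceSet _ _), hceq]
      refine ⟨hconst.add (h1.const_mul _), ?_⟩
      rw [integral_add hconst (h1.const_mul _), integral_const_mul, h2, setIntegral_const,
        measureReal_raceSet (hk s) (hk1 s), smul_eq_mul]
      simp only [hc]
      ring
    have hgint : ∀ i, Integrable (g i) ν ∧ ∫ x, g i x ∂ν ≤ P i := by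
      intro i
      by_cases hi : 0 < P i
      · simpa only [hg, hi, if_true] using integral_pareto_exponential_le ha hi i
      · simp [hg, hi, hPnn i]
    have hP1 : ∑ i, P i = 1 := by
      simp_rw [hP]
      rw [Finset.sum_comm]
      simp_rw [← Finset.mul_sum, hk1, mul_one, hp1]
    have hint1 : Integrable (fun x => ∑ s, p s * ∑ i,
        (raceSet (k s) i).indicator (fun x => c s i |x i|) x) ν :=
      integrable_finsetSum _ fun s _ =>
        (integrable_finsetSum _ fun i _ => (hcint s i).1).const_mul _
    have hint2 : Integrable (fun x => ∑ i, g i x - 1) ν :=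
      (integrable_finsetSum _ fun i _ => (hgint i).1).sub (integrable_const _)
    calc ∫ x, lawEnt p (fun s => F s x) ∂ν
        ≤ ∫ x, (∑ s, p s * ∑ i, (raceSet (k s) i).indicator (fun x => c s i |x i|) x)
            + (∑ i, g i x - 1) ∂ν := by
          refine integral_mono_ae (hG fun f => lawEnt p f).1 (hint1.add hint2) ?_
          filter_upwards [ae_all_iff.2 hFae] with x hx
          have hPpos : ∀ s, 0 < p s → 0 < P (F s x) := by
            intro s hs
            rw [hP]
            exact (mul_pos hs (hx s).1).trans_le (Finset.single_le_sum
              (f := fun s' => p s' * k s' (F s x))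
              (fun s' _ => mul_nonneg (hp s') (hk s' _)) (Finset.mem_univ s))
          refine (lawEnt_le_cross hp hp1 (fun s => F s x) (g := fun i => g i x) ?_ ?_).trans ?_
          · intro i
            simp only [hg]
            split_ifs with hi
            · positivity
            · exact le_rfl
          · intro s hs
            have := hPpos s hs
            simp only [hg, this, if_true]
            positivity
          · refine add_le_add_left (Finset.sum_le_sum fun s _ => ?_) _
            rcases (hp s).eq_or_lt with hs | hs
            · simp [← hs]
            · refine mul_le_mul_of_nonneg_left ?_ hs.le
              have hPs := hPpos s hs
              rw [Finset.sum_eq_single (F s x)]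
              · rw [Set.indicator_of_mem (hx s)]
                simp only [hg, hPs, if_true]
                exact neg_log_pareto_le ha (div_nonneg (hk s _) hPs.le)
                  (div_nonneg (abs_nonneg _) hPs.le)
              · intro i _ hi
                exact Set.indicator_of_notMem (fun h => hi (eq_of_mem_raceSet h (hx s))) _
              · simp
      _ ≤ -log a + (1 + a) * ∑ s, p s * ∑ i, k s i * log (1 + k s i / P i) := by
          rw [integral_add hint1 hint2, integral_finsetSum _ fun s _ =>
            (integrable_finsetSum _ fun i _ => (hcint s i).1).const_mul _,
            integral_sub (integrable_finsetSum _ fun i _ => (hgint i).1) (integrable_const _),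
            integral_finsetSum _ fun i _ => (hgint i).1]
          have h1 : ∀ s, ∫ x, p s * ∑ i, (raceSet (k s) i).indicator (fun x => c s i |x i|) x ∂ν
              = p s * -log a + (1 + a) * (p s * ∑ i, k s i * log (1 + k s i / P i)) := by
            intro s
            rw [integral_const_mul, integral_finsetSum _ fun i _ => (hcint s i).1]
            simp_rw [(hcint s _).2]
            rw [Finset.sum_add_distrib, ← Finset.sum_mul, hk1, ← Finset.mul_sum]
            ring
          simp_rw [h1]
          rw [Finset.sum_add_distrib, ← Finset.sum_mul, hp1, ← Finset.mul_sum]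
          have h2 := Finset.sum_le_sum fun i (_ : i ∈ Finset.univ) => (hgint i).2
          rw [hP1] at h2
          simp only [integral_const, probReal_univ, smul_eq_mul, mul_one]
          linarith

end Coupling

section Representation

theorem law_id {α : Type*} [Fintype α] (m : α → ℝ) : law m id = m := by
  classical
  funext x
  rw [law, Finset.sum_eq_single x] <;> simp +contextual

variable {σ ι κ : Type*} [Fintype σ] [Fintype ι] [Fintype κ]

theorem sum_mul_log_one_add_div_le {J : σ × ι → ℝ} (hJ : ∀ z, 0 ≤ J z) (hJ1 : ∑ z, J z = 1)
    {k : σ → ι → ℝ} (hkJ : ∀ s i, law J Prod.fst s * k s i = J (s, i)) :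
    ∑ s, law J Prod.fst s * ∑ i, k s i * log (1 + k s i / law J Prod.snd i)
      ≤ lawEnt J Prod.fst + lawEnt J Prod.snd - lawEnt J id + log 2 := by
  set p := law J Prod.fst with hp
  set P := law J Prod.snd with hP
  have hp0 : ∀ s, 0 ≤ p s := law_nonneg hJ _
  have hP0 : ∀ i, 0 ≤ P i := law_nonneg hJ _
  have hpt : ∀ z : σ × ι, J z * log (1 + k z.1 z.2 / P z.2)
      ≤ (J z * -log (p z.1) + J z * -log (P z.2) - J z * -log (J z)) + J z * log 2
        + (p z.1 * P z.2 - J z) / 2 := by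
    intro z
    rcases (hJ z).eq_or_lt with h | h
    · have := mul_nonneg (hp0 z.1) (hP0 z.2)
      simp only [← h]
      linarith
    · have h1 : 0 < p z.1 := h.trans_le (le_law hJ Prod.fst z)
      have h2 : 0 < P z.2 := h.trans_le (le_law hJ Prod.snd z)
      have h3 : k z.1 z.2 = J z / p z.1 := by
        rw [eq_div_iff h1.ne', mul_comm, hkJ]
      have h4 : log (1 + k z.1 z.2 / P z.2) = log (J z) - log (p z.1) - log (P z.2) + log 2
          + log ((1 + p z.1 * P z.2 / J z) / 2) := by
        rw [← log_div h.ne' h1.ne', ← log_div (by positivity) h2.ne',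
          ← log_mul (by positivity) two_ne_zero, ← log_mul (by positivity) (by positivity), h3]
        congr 1
        field_simp
        ring
      have h5 := log_le_sub_one_of_pos (x := (1 + p z.1 * P z.2 / J z) / 2) (by positivity)
      have h6 : J z * ((1 + p z.1 * P z.2 / J z) / 2 - 1) = (p z.1 * P z.2 - J z) / 2 := by
        field_simp
        ring
      rw [h4]
      nlinarith [mul_le_mul_of_nonneg_left h5 h.le]
  have hsum := Finset.sum_le_sum fun z (_ : z ∈ Finset.univ) => hpt z
  have hprod : ∑ z : σ × ι, p z.1 * P z.2 = 1 := by
    rw [Fintype.sum_prod_type]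
    simp only [← Finset.mul_sum, hp, hP, sum_law, hJ1, mul_one]
  simp only [lawEnt_eq_sum_log J, law_id, id]
  simp only [Finset.sum_add_distrib, Finset.sum_sub_distrib, ← Finset.sum_div, ← Finset.sum_mul,
    hprod, hJ1] at hsum
  rw [Fintype.sum_prod_type] at hsum
  simp only [Finset.mul_sum, ← mul_assoc, hkJ]
  linarith

/-- The functional representation lemma: `Y` is a function of `S` and of an independent random
function `f`, in such a way that the entropy of `Y` given `f` is close to the mutual information
of `S` and `Y`. -/
theorem exists_functional_representation [Nonempty ι] [DecidableEq σ] {J : σ × ι → ℝ}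
    (hJ : ∀ z, 0 ≤ J z) (hJ1 : ∑ z, J z = 1)
    (hI : 0 ≤ lawEnt J Prod.fst + lawEnt J Prod.snd - lawEnt J id) :
    ∃ q : (σ → ι) → ℝ, (∀ f, 0 ≤ q f) ∧ ∑ f, q f = 1 ∧
      law (fun w : σ × (σ → ι) => law J Prod.fst w.1 * q w.2) (fun w => (w.1, w.2 w.1)) = J ∧
      ∑ f, q f * lawEnt (law J Prod.fst) f
        ≤ lawEnt J Prod.fst + lawEnt J Prod.snd - lawEnt J id
          + log 2 * (logb 2 ((lawEnt J Prod.fst + lawEnt J Prod.snd - lawEnt J id) / log 2 + 1)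
            + 2) := by
  classical
  set I := lawEnt J Prod.fst + lawEnt J Prod.snd - lawEnt J id with hIdef
  set p := law J Prod.fst with hp
  have hp0 : ∀ s, 0 ≤ p s := law_nonneg hJ _
  have hp1 : ∑ s, p s = 1 := by rw [hp, sum_law, hJ1]
  have hrow : ∀ s, ∑ i, J (s, i) = p s := by
    intro s
    simp only [hp, law, Fintype.sum_prod_type]
    rw [Finset.sum_eq_single s]
    · simp
    · intro t _ ht
      simp [ht]
    · simp
  have hcard : (Fintype.card ι : ℝ) ≠ 0 := Nat.cast_ne_zero.2 Fintype.card_ne_zero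
  let k : σ → ι → ℝ := fun s i => if p s = 0 then (Fintype.card ι : ℝ)⁻¹ else J (s, i) / p s
  have hk : ∀ s i, 0 ≤ k s i := by
    intro s i
    simp only [k]
    split_ifs
    · positivity
    · exact div_nonneg (hJ _) (hp0 s)
  have hk1 : ∀ s, ∑ i, k s i = 1 := by
    intro s
    by_cases h : p s = 0
    · simp [k, h, hcard]
    · simp [k, h, ← Finset.sum_div, hrow]
  have hkJ : ∀ s i, p s * k s i = J (s, i) := by
    intro s i
    by_cases h : p s = 0
    · have : J (s, i) ≤ p s := le_law hJ Prod.fst (s, i)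
      rw [h] at this ⊢
      rw [zero_mul, this.antisymm (hJ _)]
    · simp only [k, h, if_false]
      field_simp
  have hP : ∀ i, law J Prod.snd i = ∑ s, p s * k s i := by
    intro i
    simp only [hkJ, law, Fintype.sum_prod_type]
    simp
  have hlog2 : 0 < log 2 := log_pos one_lt_two
  have hb : 0 < I / log 2 + 1 := by positivity
  obtain ⟨q, hq, hq1, hqk, hqE⟩ :=
    exists_coupling_entropy_le hp0 hp1 hk hk1 hP (a := (I / log 2 + 1)⁻¹) (by positivity)
  refine ⟨q, hq, hq1, ?_, hqE.trans ?_⟩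
  · funext z
    rw [← Prod.mk.eta (p := z), ← hkJ, ← hqk]
    simp only [law, Fintype.sum_prod_type, Prod.ext_iff]
    rw [Finset.sum_eq_single z.1]
    · simp only [true_and, Finset.mul_sum, mul_ite, mul_zero]
    · intro t _ ht
      simp [ht]
    · simp
  · have h := sum_mul_log_one_add_div_le hJ hJ1 hkJ
    rw [← hIdef] at h
    have hle := mul_le_mul_of_nonneg_left h
      (show 0 ≤ 1 + (I / log 2 + 1)⁻¹ by positivity)
    refine (add_le_add_right hle _).trans (le_of_eq ?_)
    rw [log_inv, logb]
    have : (I / log 2 + 1)⁻¹ * (I + log 2) = log 2 := by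
      field_simp
    rw [add_mul, this]
    field_simp
    ring

theorem lawEnt_comp_law {Ω : Type*} [Fintype Ω] {α : Type*} [Fintype α] {J : α → ℝ} {m : Ω → ℝ}
    {T : Ω → α} (hT : law m T = J) (g : α → κ) : lawEnt J g = lawEnt m (fun ω => g (T ω)) := by
  rw [← hT, lawEnt, law_comp, lawEnt]

theorem law_comp_equiv {Ω Ω' α : Type*} [Fintype Ω] [Fintype Ω'] (e : Ω' ≃ Ω) (m : Ω → ℝ)
    (X : Ω → α) : law (fun ω => m (e ω)) (fun ω => X (e ω)) = law m X := by
  classical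
  funext x
  exact e.sum_comp fun ω => if X ω = x then m ω else 0

theorem lawEnt_comp_equiv {Ω Ω' α : Type*} [Fintype Ω] [Fintype Ω'] [Fintype α] (e : Ω' ≃ Ω)
    (m : Ω → ℝ) (X : Ω → α) : lawEnt (fun ω => m (e ω)) (fun ω => X (e ω)) = lawEnt m X := by
  rw [lawEnt, law_comp_equiv, lawEnt]

theorem lawEnt_erasure_pair {Ω α β : Type*} [Fintype Ω] [Fintype α] [Fintype β] (m : Ω → ℝ)
    (hm : ∑ ω, m ω = 1) (X : Ω → α) (V : Ω → β) (Z : Ω → κ) (b : Bool → ℝ) :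
    lawEnt (fun ω : Ω × Bool => m ω.1 * b ω.2)
        (fun ω => ((X ω.1, if ω.2 then some (V ω.1) else none), Z ω.1))
      = negMulLog (b false) + negMulLog (b true) + b false * lawEnt m (fun ω => (X ω, Z ω))
        + b true * lawEnt m (fun ω => (X ω, V ω, Z ω)) := by
  have hX : Function.Injective fun z : (α × κ) × Option β => ((z.1.1, z.2), z.1.2) := by
    rintro ⟨⟨_, _⟩, _⟩ ⟨⟨_, _⟩, _⟩ h
    simp_all
  have hV : Function.Injective fun z : (α × κ) × β => (z.1.1, z.2, z.1.2) := by
    rintro ⟨⟨_, _⟩, _⟩ ⟨⟨_, _⟩, _⟩ h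
    simp_all
  have h := lawEnt_erasure m hm (fun ω => (X ω, Z ω)) V b
  rw [← lawEnt_inj_comp _ _ hX, ← lawEnt_inj_comp _ _ hV] at h
  exact h

theorem lawEnt_fst_prod {Ω α β : Type*} [Fintype Ω] [Fintype α] [Fintype β] (m : Ω → ℝ)
    {b : β → ℝ} (hb : ∑ i, b i = 1) (X : Ω → α) :
    lawEnt (fun ω : Ω × β => m ω.1 * b ω.2) (fun ω => X ω.1) = lawEnt m X := by
  rw [lawEnt, law_fst_prod m hb, lawEnt]

theorem lawEnt_snd_prod {Ω α β : Type*} [Fintype Ω] [Fintype α] [Fintype β] (m : Ω → ℝ)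
    (hm : ∑ ω, m ω = 1) {b : β → ℝ} (hb : ∑ i, b i = 1) (X : Ω → α) (Y : β → κ) :
    lawEnt (fun ω : Ω × β => m ω.1 * b ω.2) (fun ω => (Y ω.2, X ω.1)) = lawEnt b Y + lawEnt m X := by
  rw [add_comm, ← lawEnt_prod_pair m b hm hb]
  exact lawEnt_inj_comp _ (fun ω : Ω × β => (X ω.1, Y ω.2)) Prod.swap_injective

/-- The lower bound on a finite space: `U` consists of the random function of the functional
representation together with an independent erasure, of parameter `1 - α`, of `c S`. -/
theorem exists_representation_with_leakage [Nonempty ι] {J : σ × ι → ℝ}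
    (hJ : ∀ z, 0 ≤ J z) (hJ1 : ∑ z, J z = 1)
    (hI : 0 ≤ lawEnt J Prod.fst + lawEnt J Prod.snd - lawEnt J id) (c : σ → κ)
    {α : ℝ} (hα0 : 0 ≤ α) (hα1 : α ≤ 1) :
    ∃ (n l : ℕ) (m : Fin n → ℝ) (S : Fin n → σ) (Y : Fin n → ι) (U : Fin n → Fin l),
      (∀ ω, 0 ≤ m ω) ∧ ∑ ω, m ω = 1 ∧ law m (fun ω => (S ω, Y ω)) = J ∧
      lawEnt m U + lawEnt m S - lawEnt m (fun ω => (U ω, S ω))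
        = α * lawEnt J (fun z => c z.1) ∧
      (lawEnt J id - lawEnt J Prod.fst) + α * lawEnt J (fun z => c z.1)
          - log 2 * (logb 2 ((lawEnt J Prod.fst + lawEnt J Prod.snd - lawEnt J id) / log 2 + 1)
            + 2)
          - α * (lawEnt J (fun z => (c z.1, z.2)) - lawEnt J Prod.snd)
        ≤ lawEnt m U + lawEnt m Y - lawEnt m (fun ω => (U ω, Y ω)) := by
  classical
  obtain ⟨q, hq, hq1, hqJ, hqE⟩ := exists_functional_representation hJ hJ1 hI
  set p := law J Prod.fst with hp
  have hp0 : ∀ s, 0 ≤ p s := law_nonneg hJ _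
  have hp1 : ∑ s, p s = 1 := by rw [hp, sum_law, hJ1]
  set m₀ : σ × (σ → ι) → ℝ := fun w => p w.1 * q w.2 with hm₀
  have hm₀0 : ∀ w, 0 ≤ m₀ w := fun w => mul_nonneg (hp0 _) (hq _)
  have hm₀1 : ∑ w, m₀ w = 1 := by
    simp only [hm₀, Fintype.sum_prod_type, ← Finset.mul_sum, hq1, hp1, mul_one]
  let b : Bool → ℝ := fun t => if t then α else 1 - α
  have hb1 : ∑ t, b t = 1 := by simp [b]
  have hb0 : ∀ t, 0 ≤ b t := by
    intro t
    cases t <;> simp [b, hα0, hα1]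
  set m₁ : (σ × (σ → ι)) × Bool → ℝ := fun ω => m₀ ω.1 * b ω.2 with hm₁
  have e := (Fintype.equivFin ((σ × (σ → ι)) × Bool)).symm
  have u := Fintype.equivFin ((σ → ι) × Option κ)
  let U₁ : (σ × (σ → ι)) × Bool → (σ → ι) × Option κ := fun ω =>
    (ω.1.2, if ω.2 then some (c ω.1.1) else none)
  have hid : lawEnt q id = ∑ f, negMulLog (q f) := by
    rw [lawEnt, law_id]
  have hV : lawEnt m₀ (fun w => c w.1) = lawEnt J (fun z => c z.1) :=
    (lawEnt_comp_law hqJ fun z => c z.1).symm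
  have hS : lawEnt m₀ (fun w => w.1) = lawEnt J Prod.fst := (lawEnt_comp_law hqJ Prod.fst).symm
  have hY : lawEnt m₀ (fun w => w.2 w.1) = lawEnt J Prod.snd := (lawEnt_comp_law hqJ Prod.snd).symm
  have hVY : lawEnt m₀ (fun w => (c w.1, w.2 w.1)) = lawEnt J (fun z => (c z.1, z.2)) :=
    (lawEnt_comp_law hqJ fun z => (c z.1, z.2)).symm
  have hFX : lawEnt m₀ (fun w => w.2) = lawEnt q id := by
    have := lawEnt_snd_prod p hp1 hq1 (fun _ => ()) id
    have hu : lawEnt p (fun _ => ()) = 0 := by simp [lawEnt, law, hp1]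
    rw [hu, add_zero] at this
    rw [← this]
    exact (lawEnt_inj_comp m₀ (fun w => w.2) (g := fun f => (f, ())) fun _ _ h => by
      simpa using h).symm
  have hFV : lawEnt m₀ (fun w => (w.2, c w.1)) = lawEnt q id + lawEnt J (fun z => c z.1) := by
    rw [← hV, lawEnt_fst_prod p hq1 c]
    exact lawEnt_snd_prod p hp1 hq1 c id
  have hFS : lawEnt m₀ (fun w => (w.2, w.1)) = lawEnt q id + lawEnt J Prod.fst := by
    rw [← hS, lawEnt_fst_prod p hq1 fun s => s]
    exact lawEnt_snd_prod p hp1 hq1 (fun s => s) id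
  have hFVS : lawEnt m₀ (fun w => (w.2, c w.1, w.1)) = lawEnt m₀ (fun w => (w.2, w.1)) :=
    lawEnt_inj_comp m₀ (fun w => (w.2, w.1)) (g := fun z => (z.1, c z.2, z.2)) fun _ _ h => by
      simp_all [Prod.ext_iff]
  have hFY : lawEnt m₀ (fun w => (w.2, w.2 w.1)) = _ := lawEnt_prod_apply p hp1 q
  have hsub := lawEnt_submodular hm₀0 hm₀1 (fun w => w.2) (fun w => c w.1) (fun w => w.2 w.1)
  have hU : lawEnt m₁ U₁ = _ := lawEnt_erasure m₀ hm₀1 (fun w => w.2) (fun w => c w.1) b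
  have hUS : lawEnt m₁ (fun ω => (U₁ ω, ω.1.1)) = _ :=
    lawEnt_erasure_pair m₀ hm₀1 (fun w => w.2) (fun w => c w.1) (fun w => w.1) b
  have hUY : lawEnt m₁ (fun ω => (U₁ ω, ω.1.2 ω.1.1)) = _ :=
    lawEnt_erasure_pair m₀ hm₀1 (fun w => w.2) (fun w => c w.1) (fun w => w.2 w.1) b
  have hS₁ : lawEnt m₁ (fun ω => ω.1.1) = lawEnt J Prod.fst :=
    (lawEnt_fst_prod m₀ hb1 _).trans hS
  have hY₁ : lawEnt m₁ (fun ω => ω.1.2 ω.1.1) = lawEnt J Prod.snd :=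
    (lawEnt_fst_prod m₀ hb1 fun w => w.2 w.1).trans hY
  have hbf : b false = 1 - α := by simp [b]
  have hbt : b true = α := by simp [b]
  rw [hbf, hbt] at hU hUS hUY
  have hu : Function.Injective fun z : ((σ → ι) × Option κ) × σ => (u z.1, z.2) :=
    u.injective.prodMap Function.injective_id
  have hu' : Function.Injective fun z : ((σ → ι) × Option κ) × ι => (u z.1, z.2) :=
    u.injective.prodMap Function.injective_id
  refine ⟨_, _, fun i => m₁ (e i), fun i => (e i).1.1, fun i => (e i).1.2 (e i).1.1,
    fun i => u (U₁ (e i)), fun i => mul_nonneg (hm₀0 _) (hb0 _), ?_, ?_, ?_, ?_⟩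
  · rw [e.sum_comp m₁]
    simp only [hm₁, Fintype.sum_prod_type (α₁ := σ × (σ → ι)), ← Finset.mul_sum, hb1, mul_one,
      hm₀1]
  · rw [law_comp_equiv e m₁ fun ω => (ω.1.1, ω.1.2 ω.1.1),
      law_fst_prod m₀ hb1 fun w => (w.1, w.2 w.1), hqJ]
  · rw [lawEnt_comp_equiv e m₁ fun ω => u (U₁ ω), lawEnt_comp_equiv e m₁ fun ω => ω.1.1,
      lawEnt_comp_equiv e m₁ fun ω => (u (U₁ ω), ω.1.1), lawEnt_inj_comp _ _ u.injective,
      lawEnt_inj_comp _ (fun ω => (U₁ ω, ω.1.1)) hu, hU, hUS, hS₁, hFVS, hFS, hFV, hFX]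
    ring
  · rw [lawEnt_comp_equiv e m₁ fun ω => u (U₁ ω), lawEnt_comp_equiv e m₁ fun ω => ω.1.2 ω.1.1,
      lawEnt_comp_equiv e m₁ fun ω => (u (U₁ ω), ω.1.2 ω.1.1), lawEnt_inj_comp _ _ u.injective,
      lawEnt_inj_comp _ (fun ω => (U₁ ω, ω.1.2 ω.1.1)) hu', hU, hUY, hY₁, hFV, hFX]
    rw [hY, hVY] at hsub
    have hmul := mul_le_mul_of_nonneg_left hsub hα0
    rw [hFY, ← hid] at hmul ⊢
    linarith

end Representation

section FiniteSpace

theorem pm_comp_s5 {Ω α β : Type*} [MeasurableSpace Ω] (μ : Measure Ω) [IsFiniteMeasure μ] [Fintype α]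
    [MeasurableSpace α] [MeasurableSingletonClass α] {T : Ω → α} (hT : Measurable T) (g : α → β) :
    pm μ (fun ω => g (T ω)) = law (pm μ T) g := by
  classical
  funext y
  have hset : (fun ω => g (T ω)) ⁻¹' {y}
      = ⋃ a ∈ Finset.univ.filter (fun a => g a = y), T ⁻¹' {a} := by
    ext ω
    simp
  change μ.real _ = _
  rw [hset, measureReal_biUnion_finset _ fun a _ => hT (measurableSet_singleton a)]
  · simp only [law, Finset.sum_filter, pm, measureReal_def]
  · intro a _ a' _ h
    exact (Set.disjoint_singleton.2 h).preimage T

theorem sum_pm {Ω α : Type*} [MeasurableSpace Ω] (μ : Measure Ω) [IsProbabilityMeasure μ]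
    [Fintype α] [MeasurableSpace α] [MeasurableSingletonClass α] {T : Ω → α} (hT : Measurable T) :
    ∑ a, pm μ T a = 1 := by
  have h := congrFun (pm_comp_s5 μ hT fun _ => ()) ()
  rw [← (show _ = ∑ a, pm μ T a by simp [law] : law (pm μ T) (fun _ => ()) () = _), ← h, pm]
  simp

theorem ent_comp {Ω α β : Type*} [MeasurableSpace Ω] (μ : Measure Ω) [IsFiniteMeasure μ]
    [Fintype α] [Fintype β] [MeasurableSpace α] [MeasurableSingletonClass α] {T : Ω → α}
    (hT : Measurable T) (g : α → β) :
    ent μ (fun ω => g (T ω)) = lawEnt (pm μ T) g / log 2 := by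
  simp only [ent, pm_comp_s5 μ hT, lawEnt, negMulLog, logb, Finset.sum_div, ← Finset.sum_neg_distrib]
  exact Finset.sum_congr rfl fun x _ => by ring

/-- The discrete measure with weights `m`. -/
def weighted {n : ℕ} (m : Fin n → ℝ) : Measure (Fin n) :=
  ∑ i, ENNReal.ofReal (m i) • Measure.dirac i

theorem weighted_singleton {n : ℕ} (m : Fin n → ℝ) (i : Fin n) :
    weighted m {i} = ENNReal.ofReal (m i) := by
  rw [weighted, Measure.finsetSum_apply, Finset.sum_eq_single i] <;> simp +contextual

theorem isProbabilityMeasure_weighted {n : ℕ} {m : Fin n → ℝ} (hm : ∀ i, 0 ≤ m i)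
    (hm1 : ∑ i, m i = 1) : IsProbabilityMeasure (weighted m) := by
  constructor
  rw [weighted, Measure.finsetSum_apply]
  simp [← ENNReal.ofReal_sum_of_nonneg fun i _ => hm i, hm1]

theorem pm_weighted_id {n : ℕ} {m : Fin n → ℝ} (hm : ∀ i, 0 ≤ m i) :
    pm (weighted m) id = m := by
  funext i
  simp [pm, weighted_singleton, hm]

theorem pm_weighted {n : ℕ} {m : Fin n → ℝ} (hm : ∀ i, 0 ≤ m i) (hm1 : ∑ i, m i = 1)
    {β : Type*} (X : Fin n → β) : pm (weighted m) X = law m X := by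
  have := isProbabilityMeasure_weighted hm hm1
  have h := pm_comp_s5 (weighted m) measurable_id X
  rwa [pm_weighted_id hm] at h

theorem ent_weighted {n : ℕ} {m : Fin n → ℝ} (hm : ∀ i, 0 ≤ m i) (hm1 : ∑ i, m i = 1)
    {β : Type*} [Fintype β] (X : Fin n → β) : ent (weighted m) X = lawEnt m X / log 2 := by
  have := isProbabilityMeasure_weighted hm hm1
  have h := ent_comp (weighted m) measurable_id X
  rwa [pm_weighted_id hm] at h

theorem mi_weighted {n : ℕ} {m : Fin n → ℝ} (hm : ∀ i, 0 ≤ m i) (hm1 : ∑ i, m i = 1)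
    {β γ : Type*} [Fintype β] [Fintype γ] (X : Fin n → β) (Y : Fin n → γ) :
    mi (weighted m) X Y
      = (lawEnt m X + lawEnt m Y - lawEnt m (fun i => (X i, Y i))) / log 2 := by
  simp only [mi, ent_weighted hm hm1]
  ring

theorem map_eq_of_pm_eq {Ω Ω' α : Type*} [MeasurableSpace Ω] [MeasurableSpace Ω']
    (μ : Measure Ω) [IsFiniteMeasure μ] (μ' : Measure Ω') [IsFiniteMeasure μ'] [Fintype α]
    [MeasurableSpace α] [MeasurableSingletonClass α] {X : Ω → α} {X' : Ω' → α}
    (hX : Measurable X) (hX' : Measurable X') (h : pm μ X = pm μ' X') :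
    μ.map X = μ'.map X' := by
  refine Measure.ext_of_singleton fun a => ?_
  rw [Measure.map_apply hX (measurableSet_singleton a),
    Measure.map_apply hX' (measurableSet_singleton a)]
  exact (ENNReal.toReal_eq_toReal_iff' (measure_ne_top _ _) (measure_ne_top _ _)).1
    (congrFun h a)

end FiniteSpace

/-- lower bound `L_h^3(ε)` of Theorem 1 for a fixed representation
`S = (S1,S2)`. With `0 ≤ ε < I(S;Y)`, `ε ≤ H(S2)`, `H(S2) > 0` and `α2 = ε/H(S2)`, there is a
probability space carrying `(S1',S2',Y')` distributed as `(S1,S2,Y)` and a finite-valued `U`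
with `I(U;(S1',S2')) ≤ ε` and
`I(U;Y') ≥ H(Y|S) + ε − (log₂(I(S;Y)+1) + 4) − α2·H(S2|Y)`. -/
theorem exists_lower_bound_L3
    {Ω : Type*} [MeasurableSpace Ω] (μ : Measure Ω) [IsProbabilityMeasure μ]
    {𝒮₁ 𝒮₂ 𝒴 : Type*}
    [Fintype 𝒮₁] [Nonempty 𝒮₁] [MeasurableSpace 𝒮₁] [MeasurableSingletonClass 𝒮₁]
    [Fintype 𝒮₂] [Nonempty 𝒮₂] [MeasurableSpace 𝒮₂] [MeasurableSingletonClass 𝒮₂]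
    [Fintype 𝒴] [Nonempty 𝒴] [MeasurableSpace 𝒴] [MeasurableSingletonClass 𝒴]
    (S₁ : Ω → 𝒮₁) (S₂ : Ω → 𝒮₂) (Y : Ω → 𝒴)
    (hS₁ : Measurable S₁) (hS₂ : Measurable S₂) (hY : Measurable Y)
    (ε : ℝ) (hε0 : 0 ≤ ε) (hε : ε < mi μ (fun ω => (S₁ ω, S₂ ω)) Y)
    (hH2 : 0 < ent μ S₂) (hε2 : ε ≤ ent μ S₂)
    (α₂ : ℝ) (hα₂ : α₂ = ε / ent μ S₂) :
    ∃ (Ω' : Type) (mΩ' : MeasurableSpace Ω'), haveI := mΩ';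
    ∃ (μ' : Measure Ω'), IsProbabilityMeasure μ' ∧
    ∃ (S₁' : Ω' → 𝒮₁) (S₂' : Ω' → 𝒮₂) (Y' : Ω' → 𝒴),
      Measurable S₁' ∧ Measurable S₂' ∧ Measurable Y' ∧
      Measure.map (fun ω => (S₁' ω, S₂' ω, Y' ω)) μ'
        = Measure.map (fun ω => (S₁ ω, S₂ ω, Y ω)) μ ∧
      ∃ (𝒰 : Type) (iF : Fintype 𝒰) (iN : Nonempty 𝒰) (iM : MeasurableSpace 𝒰),
        haveI := iF; haveI := iM;
      ∃ (iMS : MeasurableSingletonClass 𝒰) (U : Ω' → 𝒰), Measurable U ∧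
        mi μ' U (fun ω => (S₁' ω, S₂' ω)) ≤ ε ∧
        condEnt μ Y (fun ω => (S₁ ω, S₂ ω)) + ε
            - (Real.logb 2 (mi μ (fun ω => (S₁ ω, S₂ ω)) Y + 1) + 4)
            - α₂ * condEnt μ S₂ Y ≤ mi μ' U Y' := by
  set J : (𝒮₁ × 𝒮₂) × 𝒴 → ℝ := pm μ (fun ω => ((S₁ ω, S₂ ω), Y ω)) with hJdef
  have hT : Measurable fun ω => ((S₁ ω, S₂ ω), Y ω) := (hS₁.prodMk hS₂).prodMk hY
  have hJ : ∀ z, 0 ≤ J z := fun z => ENNReal.toReal_nonneg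
  have hJ1 : ∑ z, J z = 1 := sum_pm μ hT
  have hlog : 0 < log 2 := log_pos one_lt_two
  have hS : ent μ (fun ω => (S₁ ω, S₂ ω)) = lawEnt J Prod.fst / log 2 := ent_comp μ hT Prod.fst
  have hS2 : ent μ S₂ = lawEnt J (fun z => z.1.2) / log 2 := ent_comp μ hT fun z => z.1.2
  have hYe : ent μ Y = lawEnt J Prod.snd / log 2 := ent_comp μ hT Prod.snd
  have hSY : ent μ (fun ω => ((S₁ ω, S₂ ω), Y ω)) = lawEnt J id / log 2 := ent_comp μ hT id
  have hYS : ent μ (fun ω => (Y ω, S₁ ω, S₂ ω)) = lawEnt J id / log 2 := by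
    rw [← lawEnt_inj_comp J id Prod.swap_injective]
    exact ent_comp μ hT Prod.swap
  have hS2Y : ent μ (fun ω => (S₂ ω, Y ω)) = lawEnt J (fun z => (z.1.2, z.2)) / log 2 :=
    ent_comp μ hT fun z => (z.1.2, z.2)
  have hmi : mi μ (fun ω => (S₁ ω, S₂ ω)) Y
      = (lawEnt J Prod.fst + lawEnt J Prod.snd - lawEnt J id) / log 2 := by
    rw [mi, hS, hYe, hSY]
    ring
  have hI : 0 ≤ lawEnt J Prod.fst + lawEnt J Prod.snd - lawEnt J id := by
    have := (hε0.trans_lt hε).le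
    rw [hmi] at this
    rwa [le_div_iff₀ hlog, zero_mul] at this
  have hα0 : 0 ≤ α₂ := hα₂ ▸ div_nonneg hε0 hH2.le
  have hα1 : α₂ ≤ 1 := hα₂ ▸ div_le_one_of_le₀ hε2 hH2.le
  have hαε : α₂ * (lawEnt J (fun z => z.1.2) / log 2) = ε := by
    rw [← hS2, hα₂, div_mul_cancel₀ _ hH2.ne']
  obtain ⟨n, l, m, S, Y', U, hm, hm1, hmJ, hUS, hUY⟩ :=
    exists_representation_with_leakage hJ hJ1 hI Prod.snd hα0 hα1
  have hprob := isProbabilityMeasure_weighted hm hm1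
  have hass : Measurable fun ω => (S₁ ω, S₂ ω, Y ω) := hS₁.prodMk (hS₂.prodMk hY)
  have : Nonempty (Fin n) := by
    by_contra h
    rw [not_nonempty_iff] at h
    simp at hm1
  refine ⟨Fin n, ⊤, weighted m, hprob, fun ω => (S ω).1, fun ω => (S ω).2, Y',
    measurable_from_top, measurable_from_top, measurable_from_top, ?_,
    Fin l, inferInstance, Nonempty.map U this, ⊤, ⟨fun _ => trivial⟩, U, measurable_from_top,
    ?_, ?_⟩
  · refine map_eq_of_pm_eq _ _ measurable_from_top hass ?_
    rw [pm_weighted hm hm1, pm_comp_s5 μ hT fun z => (z.1.1, z.1.2, z.2), ← hJdef, ← hmJ, law_comp]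
  · refine ((mi_weighted hm hm1 U S).trans ?_).le
    rw [hUS, ← hαε, mul_div_assoc]
  · have h := div_le_div_of_nonneg_right hUY hlog.le
    rw [mi_weighted hm hm1, condEnt, condEnt, hYS, hS, hS2Y, hYe, hmi, ← hαε]
    refine le_trans ?_ h
    have hcancel : ∀ x, log 2 * x / log 2 = x := fun x => mul_div_cancel_left₀ x hlog.ne'
    generalize logb 2 _ = L
    rw [sub_div, sub_div, hcancel, add_div, sub_div, mul_div_assoc, mul_div_assoc, sub_div]
    linarith
end
end
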